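/- arXiv:1310.6283 — 2 statements merged into one kernel-verified Lean document; each statement's English description precedes it below -/
import Mathlib

section
/- Let G be a group generated by a finite set X, let A = X ⊕ X be the alphabet of two disjoint copies of X, and let π : A* → G be the canonical monoid homomorphism. Then the word problem W_A(G) = { w ∈ A* : π(w) = 1 } is a context-free language if and only if G is virtually free, i.e. G contains a subgroup H of finite index such that H is a free group. -/
/-- The canonical monoid homomorphism `A* → G` for the alphabet `A = X ⊕ X`,
sending the first copy of `x` to `f x` and the second copy to `(f x)⁻¹`. -/
def wordProblemHom {X G : Type} [Group G] (f : X → G) : FreeMonoid (X ⊕ X) →* G :=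
  FreeMonoid.lift (Sum.elim f fun x => (f x)⁻¹)

/-- The word problem of `G` with respect to the alphabet `A = X ⊕ X`. -/
def wordProblem {X G : Type} [Group G] (f : X → G) : Language (X ⊕ X) :=
  { w : List (X ⊕ X) | wordProblemHom f (FreeMonoid.ofList w) = 1 }

/-- A group is virtually free if it has a free subgroup of finite index. -/
def VirtuallyFree (G : Type) [Group G] : Prop :=
  ∃ H : Subgroup G, H.FiniteIndex ∧ IsFreeGroup H

namespace MullerSchupp

open scoped Pointwise

section Sets

variable {G : Type}

lemma eq_or_compl_of_symmDiff {U D : Set G} (h : symmDiff U D = ∅ ∨ symmDiff U D = Set.univ) :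
    U = D ∨ U = Dᶜ := by
  rcases h with h | h
  · left
    rwa [← Set.bot_eq_empty, symmDiff_eq_bot] at h
  · right
    ext x
    have : x ∈ symmDiff U D := by rw [h]; trivial
    rw [Set.mem_symmDiff] at this
    rw [Set.mem_compl_iff]
    tauto

/-- Two cuts are nested if one of their four corners is empty. -/
def Nested (C D : Set G) : Prop := C ⊆ D ∨ C ⊆ Dᶜ ∨ Cᶜ ⊆ D ∨ Cᶜ ⊆ Dᶜ

lemma Nested.symm {C D : Set G} (h : Nested C D) : Nested D C := by
  unfold Nested at *
  rcases h with h | h | h | h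
  · right; right; right; exact Set.compl_subset_compl.mpr h
  · right; left; exact Set.subset_compl_comm.mp h
  · right; right; left; exact Set.compl_subset_comm.mp h
  · left; exact Set.compl_subset_compl.mp h

lemma nested_compl_right {C D : Set G} : Nested C Dᶜ ↔ Nested C D := by
  unfold Nested
  rw [compl_compl]
  tauto

lemma nested_compl_left {C D : Set G} : Nested Cᶜ D ↔ Nested C D := by
  unfold Nested
  rw [compl_compl]
  tauto

end Sets

section Cuts

variable {X G : Type} [Group G]

/-- The coboundary of a set of vertices of the Cayley graph. -/
def cob (f : X → G) (D : Set G) : Set (G × X) :=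
  {e | ¬ (e.1 ∈ D ↔ e.1 * f e.2 ∈ D)}

variable {f : X → G}

lemma mem_cob {D : Set G} {e : G × X} : e ∈ cob f D ↔ ¬ (e.1 ∈ D ↔ e.1 * f e.2 ∈ D) := Iff.rfl

@[simp] lemma cob_compl (D : Set G) : cob f Dᶜ = cob f D := by
  ext e
  simp only [mem_cob, Set.mem_compl_iff]
  tauto

lemma cob_symmDiff (C D : Set G) : cob f (symmDiff C D) = symmDiff (cob f C) (cob f D) := by
  ext e
  simp only [mem_cob, Set.mem_symmDiff]
  tauto

lemma mem_cob_smul {g : G} {D : Set G} {e : G × X} :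
    e ∈ cob f (g • D) ↔ (g⁻¹ * e.1, e.2) ∈ cob f D := by
  simp only [mem_cob, Set.mem_smul_set_iff_inv_smul_mem, smul_eq_mul, mul_assoc]

lemma cob_smul (g : G) (D : Set G) :
    cob f (g • D) = (fun e : G × X => (g * e.1, e.2)) '' cob f D := by
  ext e
  rw [mem_cob_smul]
  constructor
  · intro h
    exact ⟨_, h, by simp⟩
  · rintro ⟨e, h, rfl⟩
    simpa using h

lemma ncard_cob_smul (g : G) (D : Set G) : (cob f (g • D)).ncard = (cob f D).ncard := by
  rw [cob_smul, Set.ncard_image_of_injective]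
  rintro ⟨a, b⟩ ⟨c, d⟩ h
  simpa using h

lemma finite_cob_smul {g : G} {D : Set G} (h : (cob f D).Finite) : (cob f (g • D)).Finite := by
  rw [cob_smul]
  exact h.image _

lemma eq_empty_or_univ_of_cob_eq_empty (hgen : Subgroup.closure (Set.range f) = ⊤) {U : Set G}
    (hU : cob f U = ∅) : U = ∅ ∨ U = Set.univ := by
  have key : ∀ g h : G, h ∈ U ↔ h * g ∈ U := by
    intro g
    have hg : g ∈ Subgroup.closure (Set.range f) := by rw [hgen]; trivial
    induction hg using Subgroup.closure_induction with
    | mem y hy =>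
      obtain ⟨x, rfl⟩ := hy
      intro h
      by_contra hc
      have : (h, x) ∈ cob f U := hc
      rw [hU] at this
      exact this
    | one => simp
    | mul a b _ _ iha ihb =>
      intro h
      rw [iha h, ihb (h * a), mul_assoc]
    | inv a _ iha =>
      intro h
      rw [iha (h * a⁻¹)]
      simp
  rcases U.eq_empty_or_nonempty with h | ⟨u, hu⟩
  · exact Or.inl h
  · right
    ext v
    simpa using (key (u⁻¹ * v) u).mp hu

lemma cob_corners_subset (C D : Set G) :
    cob f (C ∩ D) ∪ cob f (Cᶜ ∩ Dᶜ) ⊆ cob f C ∪ cob f D := by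
  intro e
  simp only [mem_cob, Set.mem_union, Set.mem_inter_iff, Set.mem_compl_iff]
  tauto

lemma cob_corners_inter_subset (C D : Set G) :
    cob f (C ∩ D) ∩ cob f (Cᶜ ∩ Dᶜ) ⊆ cob f C ∩ cob f D := by
  intro e
  simp only [mem_cob, Set.mem_inter_iff, Set.mem_compl_iff]
  tauto

lemma finite_cob_inter {C D : Set G} (hC : (cob f C).Finite) (hD : (cob f D).Finite) :
    (cob f (C ∩ D)).Finite :=
  (hC.union hD).subset (Set.subset_union_left.trans (cob_corners_subset C D))

lemma ncard_cob_corners {C D : Set G} (hC : (cob f C).Finite) (hD : (cob f D).Finite) :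
    (cob f (C ∩ D)).ncard + (cob f (Cᶜ ∩ Dᶜ)).ncard ≤ (cob f C).ncard + (cob f D).ncard := by
  have h1 := finite_cob_inter hC hD
  have h2 : (cob f (Cᶜ ∩ Dᶜ)).Finite :=
    finite_cob_inter (by rwa [cob_compl]) (by rwa [cob_compl])
  rw [← Set.ncard_union_add_ncard_inter _ _ h1 h2, ← Set.ncard_union_add_ncard_inter _ _ hC hD]
  exact add_le_add (Set.ncard_le_ncard (cob_corners_subset C D) (hC.union hD))
    (Set.ncard_le_ncard (cob_corners_inter_subset C D) (hC.inter_of_left _))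

/-- A cut is tight if its coboundary is minimal among nonempty coboundaries. -/
def Tight (f : X → G) (D : Set G) : Prop :=
  ∀ U, cob f U ⊆ cob f D → U = D ∨ U = Dᶜ ∨ U = ∅ ∨ U = Set.univ

lemma Tight.compl {D : Set G} (h : Tight f D) : Tight f Dᶜ := by
  intro U hU
  rw [cob_compl] at hU
  rw [compl_compl]
  have := h U hU
  tauto

lemma Tight.smul {D : Set G} (h : Tight f D) (g : G) : Tight f (g • D) := by
  intro U hU
  have h1 : cob f (g⁻¹ • U) ⊆ cob f D := by
    intro e he
    rw [mem_cob_smul] at he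
    have := hU he
    rw [mem_cob_smul] at this
    simpa using this
  have := h _ h1
  rw [inv_smul_eq_iff, inv_smul_eq_iff, inv_smul_eq_iff, inv_smul_eq_iff, Set.smul_set_compl,
    Set.smul_set_empty, Set.smul_set_univ] at this
  exact this

/-- A cut of minimal size among those in a separating family is tight. -/
lemma tight_of_minimal (hgen : Subgroup.closure (Set.range f) = ⊤) {P : Set G → Prop} {D : Set G}
    (hfin : (cob f D).Finite)
    (hmin : ∀ E, P E → (cob f E).Finite → (cob f D).ncard ≤ (cob f E).ncard)
    (hP : ∀ U, cob f U ⊆ cob f D → P U ∨ P Uᶜ ∨ P (symmDiff U D) ∨ P (symmDiff U D)ᶜ) :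
    Tight f D := by
  intro U hU
  have hUf := hfin.subset hU
  have hs : cob f (symmDiff U D) = cob f D \ cob f U := by
    rw [cob_symmDiff, symmDiff_of_le hU]
  have h1 : (cob f D).ncard ≤ (cob f U).ncard → U = D ∨ U = Dᶜ := by
    intro h
    have := Set.eq_of_subset_of_ncard_le hU h hfin
    apply eq_or_compl_of_symmDiff
    apply eq_empty_or_univ_of_cob_eq_empty hgen (f := f)
    rw [hs, this, Set.sdiff_self]
  have h2 : (cob f D).ncard ≤ (cob f (symmDiff U D)).ncard → U = ∅ ∨ U = Set.univ := by
    intro h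
    apply eq_empty_or_univ_of_cob_eq_empty hgen (f := f)
    rw [hs] at h
    have := Set.eq_of_subset_of_ncard_le Set.sdiff_subset h hfin
    rw [sdiff_eq_left] at this
    exact disjoint_self.mp (this.mono_left hU)
  have hsf : (cob f (symmDiff U D)).Finite := by rw [hs]; exact hfin.sdiff
  rcases hP U hU with h | h | h | h
  · have := h1 (hmin _ h hUf); tauto
  · have := h1 (by simpa using hmin _ h (by simpa using hUf)); tauto
  · have := h2 (hmin _ h hsf); tauto
  · have := h2 (by simpa only [cob_compl] using hmin _ h (by rwa [cob_compl])); tauto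

/-- There are only finitely many tight cuts of bounded size separating two given vertices. -/
lemma finite_tight (k : ℕ) (x z : G) :
    {D : Set G | Tight f D ∧ (cob f D).Finite ∧ (cob f D).ncard ≤ k ∧ x ∈ D ∧ z ∉ D}.Finite := by
  by_contra hinf
  set 𝒟 := {D : Set G | Tight f D ∧ (cob f D).Finite ∧ (cob f D).ncard ≤ k ∧ x ∈ D ∧ z ∉ D}
    with h𝒟
  have : Infinite 𝒟 := Set.infinite_coe_iff.mpr hinf
  let u : Ultrafilter 𝒟 := Filter.hyperfilter 𝒟
  let D : Set G := {g | ∀ᶠ E : 𝒟 in u, g ∈ E.1}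
  have hcob : ∀ e, e ∈ cob f D → ∀ᶠ E : 𝒟 in u, e ∈ cob f E.1 := by
    intro e he
    simp only [mem_cob, D, Set.mem_ofPred_eq] at he ⊢
    rw [Ultrafilter.eventually_not]
    intro h
    apply he
    constructor
    · intro h1
      filter_upwards [h, h1] with E h h1 using h.mp h1
    · intro h1
      filter_upwards [h, h1] with E h h1 using h.mpr h1
  have hev : ∀ s : Finset (G × X), (s : Set (G × X)) ⊆ cob f D →
      ∀ᶠ E : 𝒟 in u, (s : Set (G × X)) ⊆ cob f E.1 := by
    intro s hs
    have := (Filter.eventually_all_finset (l := (u : Filter 𝒟)) s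
      (p := fun e E => e ∈ cob f E.1)).mpr (fun e he => hcob e (hs he))
    filter_upwards [this] with E hE e he using hE e he
  have hfin : (cob f D).Finite := by
    by_contra hc
    obtain ⟨s, hs, hsk⟩ := Set.Infinite.exists_subset_card_eq hc (k + 1)
    obtain ⟨E, hE⟩ := (hev s hs).exists
    have h1 := Set.ncard_le_ncard hE E.2.2.1
    have h2 := E.2.2.2.1
    rw [Set.ncard_coe_finset] at h1
    omega
  have hsub : ∀ᶠ E : 𝒟 in u, cob f D ⊆ cob f E.1 := by
    have := hev hfin.toFinset (by simp)
    simpa using this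
  have hx : x ∈ D := Filter.Eventually.of_forall (fun E => E.2.2.2.2.1)
  have hz : z ∉ D := by
    change ¬ (∀ᶠ E : 𝒟 in u, z ∈ E.1)
    rw [← Ultrafilter.eventually_not]
    exact Filter.Eventually.of_forall (fun E => E.2.2.2.2.2)
  have heq : ∀ᶠ E : 𝒟 in u, D = E.1 := by
    filter_upwards [hsub] with E hE
    rcases E.2.1 D hE with h | h | h | h
    · exact h
    · exact absurd E.2.2.2.2.1 (by rw [h] at hx; exact hx)
    · rw [h] at hx; exact hx.elim
    · rw [h] at hz; exact (hz trivial).elim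
  obtain ⟨E, hE⟩ := heq.exists
  have hfin : ({E} : Set 𝒟).Finite := Set.finite_singleton E
  have h3 : ({E} : Set 𝒟)ᶜ ∈ (u : Filter 𝒟) := hfin.compl_mem_hyperfilter
  have h4 : ({E} : Set 𝒟) ∈ (u : Filter 𝒟) := by
    filter_upwards [heq] with E' hE'
    exact Subtype.ext (hE'.symm.trans hE)
  exact (Ultrafilter.compl_mem_iff_notMem.mp h3) h4

lemma nested_smul {C D : Set G} (g : G) : Nested (g • C) (g • D) ↔ Nested C D := by
  simp [Nested, ← Set.smul_set_compl]

/-- The nontrivial tight cuts of size at most `k`. -/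
def TightCut (f : X → G) (k : ℕ) : Set (Set G) :=
  {D | Tight f D ∧ (cob f D).Finite ∧ (cob f D).ncard ≤ k ∧ D.Nonempty ∧ Dᶜ.Nonempty}

lemma TightCut.smul {k : ℕ} {D : Set G} (h : D ∈ TightCut f k) (g : G) : g • D ∈ TightCut f k := by
  obtain ⟨h1, h2, h3, h4, h5⟩ := h
  refine ⟨h1.smul g, finite_cob_smul h2, by rwa [ncard_cob_smul], h4.smul_set, ?_⟩
  rw [← Set.smul_set_compl]
  exact h5.smul_set

lemma TightCut.compl {k : ℕ} {D : Set G} (h : D ∈ TightCut f k) : Dᶜ ∈ TightCut f k := by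
  obtain ⟨h1, h2, h3, h4, h5⟩ := h
  exact ⟨h1.compl, by rwa [cob_compl], by rwa [cob_compl], h5, by rwa [compl_compl]⟩

lemma TightCut.finite_separating (k : ℕ) (x z : G) :
    {D | D ∈ TightCut f k ∧ x ∈ D ∧ z ∉ D}.Finite :=
  (finite_tight (f := f) k x z).subset fun _ ⟨h, hx, hz⟩ => ⟨h.1, h.2.1, h.2.2.1, hx, hz⟩

lemma cob_nonempty (hgen : Subgroup.closure (Set.range f) = ⊤) {D : Set G} (h : D.Nonempty)
    (h' : Dᶜ.Nonempty) : (cob f D).Nonempty := by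
  rw [Set.nonempty_iff_ne_empty]
  intro hc
  rcases eq_empty_or_univ_of_cob_eq_empty hgen hc with h | h <;> simp_all

/-- The endpoints of the coboundary. -/
def ends (f : X → G) (D : Set G) : Set G :=
  Prod.fst '' cob f D ∪ (fun e : G × X => e.1 * f e.2) '' cob f D

lemma nested_of_ends_subset {D E : Set G} (hE : Tight f E) (h : ends f D ⊆ E) : Nested D E := by
  have hsub : cob f (D ∩ Eᶜ) ⊆ cob f E := by
    intro e he
    by_contra hc
    have h1 : e ∈ cob f D → e.1 ∈ E ∧ e.1 * f e.2 ∈ E := fun hd =>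
      ⟨h (Or.inl ⟨e, hd, rfl⟩), h (Or.inr ⟨e, hd, rfl⟩)⟩
    simp only [mem_cob, Set.mem_inter_iff, Set.mem_compl_iff] at *
    tauto
  rcases hE _ hsub with h | h | h | h
  · right; left
    intro x hx hxE
    rw [← h] at hxE
    exact hxE.2 (by rw [← h]; exact hxE)
  · right; right; left
    rw [Set.compl_subset_comm, ← h]
    exact Set.inter_subset_left
  · left
    intro x hx
    by_contra hc
    have : x ∈ D ∩ Eᶜ := ⟨hx, hc⟩
    rw [h] at this
    exact this
  · right; left
    intro x hx
    have : x ∈ D ∩ Eᶜ := by rw [h]; trivial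
    exact this.2

lemma finite_crossing {k : ℕ} {D : Set G} (hD : (cob f D).Finite) :
    {E | E ∈ TightCut f k ∧ ¬ Nested D E}.Finite := by
  have hends : (ends f D).Finite := (hD.image _).union (hD.image _)
  have : (⋃ x ∈ ends f D, ⋃ z ∈ ends f D, {E | E ∈ TightCut f k ∧ x ∈ E ∧ z ∉ E}).Finite :=
    hends.biUnion fun x _ => hends.biUnion fun z _ => TightCut.finite_separating k x z
  refine this.subset ?_
  rintro E ⟨hE, hn⟩
  have h1 : ¬ ends f D ⊆ E := fun h => hn (nested_of_ends_subset hE.1 h)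
  have h2 : ¬ ends f D ⊆ Eᶜ := fun h =>
    hn (nested_compl_right.mp (nested_of_ends_subset hE.1.compl h))
  rw [Set.not_subset] at h1 h2
  obtain ⟨z, hz, hzE⟩ := h1
  obtain ⟨x, hx, hxE⟩ := h2
  simp only [Set.mem_iUnion]
  exact ⟨x, hx, z, hz, hE, by simpa using hxE, hzE⟩

lemma finite_smul_eq (hgen : Subgroup.closure (Set.range f) = ⊤) {k : ℕ} {D : Set G}
    (hD : D ∈ TightCut f k) (E : Set G) : {g : G | g • D = E}.Finite := by
  obtain ⟨e, he⟩ := cob_nonempty hgen hD.2.2.2.1 hD.2.2.2.2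
  by_cases hEf : (cob f E).Finite
  · refine Set.Finite.of_finite_image (f := fun g => ((g * e.1, e.2) : G × X)) (hEf.subset ?_) ?_
    · rintro _ ⟨g, rfl, rfl⟩
      rw [mem_cob_smul]
      simpa using he
    · intro g _ h _ hgh
      simpa using hgh
  · convert Set.finite_empty
    ext g
    simp only [Set.mem_ofPred_eq, Set.mem_empty_iff_false, iff_false]
    rintro rfl
    exact hEf (finite_cob_smul hD.2.1)

/-- There are finitely many orbits of tight cuts of bounded size. -/
lemma exists_finite_orbit_representatives [Finite X]
    (hgen : Subgroup.closure (Set.range f) = ⊤) (k : ℕ) :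
    ∃ R : Set (Set G), R.Finite ∧ R ⊆ TightCut f k ∧
      ∀ D ∈ TightCut f k, ∃ g : G, g • D ∈ R := by
  refine ⟨(⋃ x : X, {D | D ∈ TightCut f k ∧ 1 ∈ D ∧ f x ∉ D}) ∪
    ⋃ x : X, {D | D ∈ TightCut f k ∧ f x ∈ D ∧ 1 ∉ D}, ?_, ?_, ?_⟩
  · exact (Set.finite_iUnion fun x => TightCut.finite_separating k _ _).union
      (Set.finite_iUnion fun x => TightCut.finite_separating k _ _)
  · intro D
    simp only [Set.mem_union, Set.mem_iUnion]
    rintro (⟨x, h⟩ | ⟨x, h⟩) <;> exact h.1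
  · intro D hD
    obtain ⟨e, he⟩ := cob_nonempty hgen hD.2.2.2.1 hD.2.2.2.2
    refine ⟨e.1⁻¹, ?_⟩
    have h1 : (1 : G) ∈ e.1⁻¹ • D ↔ e.1 ∈ D := by
      simp [Set.mem_smul_set_iff_inv_smul_mem]
    have h2 : f e.2 ∈ e.1⁻¹ • D ↔ e.1 * f e.2 ∈ D := by
      simp [Set.mem_smul_set_iff_inv_smul_mem]
    have h3 := TightCut.smul hD e.1⁻¹
    rw [mem_cob, ← h1, ← h2] at he
    simp only [Set.mem_union, Set.mem_iUnion]
    by_cases h : (1 : G) ∈ e.1⁻¹ • D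
    · exact Or.inl ⟨e.2, h3, h, by tauto⟩
    · exact Or.inr ⟨e.2, h3, by tauto, h⟩

end Cuts

lemma Nested.inter {G : Type} {C D E : Set G} (h1 : Nested C E) (h2 : Nested D E)
    (hCD : ¬ Nested C D) : Nested (C ∩ D) E := by
  unfold Nested at h1 h2 ⊢
  simp only [Set.compl_inter, Set.union_subset_iff]
  rcases h1 with h | h | h | h
  · exact Or.inl (Set.inter_subset_left.trans h)
  · exact Or.inr (Or.inl (Set.inter_subset_left.trans h))
  all_goals
    rcases h2 with h' | h' | h' | h'
    · exact Or.inl (Set.inter_subset_right.trans h')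
    · exact Or.inr (Or.inl (Set.inter_subset_right.trans h'))
  · exact Or.inr (Or.inr (Or.inl ⟨h, h'⟩))
  · exact absurd (Or.inr (Or.inr (Or.inl (h.trans (Set.compl_subset_compl.mp h'))))) hCD
  · exact absurd (Or.inr (Or.inr (Or.inl (h.trans (Set.compl_subset_comm.mp h'))))) hCD
  · exact Or.inr (Or.inr (Or.inr ⟨h, h'⟩))

lemma inter_mem_ultrafilter {G : Type} {u : Ultrafilter G} {A B : Set G} : A ∩ B ∈ u ↔ A ∈ u ∧ B ∈ u := by
  rw [← Ultrafilter.mem_coe, Filter.inter_mem_iff]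
  rfl

section OptimalCuts

variable {X G : Type} [Group G] {f : X → G} {k : ℕ}

/-- `D` is a cut of minimal size among those separating `p` from `q`, and this size is at
most `k`. -/
structure MinCut (f : X → G) (k : ℕ) (p q : Ultrafilter G) (D : Set G) : Prop where
  mem : D ∈ p
  notMem : D ∉ q
  finite : (cob f D).Finite
  le : (cob f D).ncard ≤ k
  min : ∀ E, E ∈ p → E ∉ q → (cob f E).Finite → (cob f D).ncard ≤ (cob f E).ncard

/-- The cuts of minimal size for some pair of ultrafilters. -/
def minCuts (f : X → G) (k : ℕ) : Set (Set G) := {D | ∃ p q, MinCut f k p q D}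

lemma MinCut.compl {p q : Ultrafilter G} {D : Set G} (h : MinCut f k p q D) :
    MinCut f k q p Dᶜ where
  mem := Ultrafilter.compl_mem_iff_notMem.mpr h.notMem
  notMem := fun hc => Ultrafilter.compl_mem_iff_notMem.mp hc h.mem
  finite := by simpa using h.finite
  le := by simpa using h.le
  min := fun E hq hp hE => by
    have := h.min Eᶜ (Ultrafilter.compl_mem_iff_notMem.mpr hp)
      (fun hc => Ultrafilter.compl_mem_iff_notMem.mp hc hq) (by simpa using hE)
    simpa using this

lemma mem_map_smul {p : Ultrafilter G} {g : G} {D : Set G} :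
    D ∈ p.map (g • ·) ↔ g⁻¹ • D ∈ p := by
  rw [Ultrafilter.mem_map, Set.preimage_smul]

lemma MinCut.smul {p q : Ultrafilter G} {D : Set G} (h : MinCut f k p q D) (g : G) :
    MinCut f k (p.map (g • ·)) (q.map (g • ·)) (g • D) where
  mem := by rw [mem_map_smul, inv_smul_smul]; exact h.mem
  notMem := by rw [mem_map_smul, inv_smul_smul]; exact h.notMem
  finite := finite_cob_smul h.finite
  le := by rw [ncard_cob_smul]; exact h.le
  min := fun E hp hq hE => by
    rw [mem_map_smul] at hp hq
    have := h.min _ hp hq (finite_cob_smul hE)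
    rwa [ncard_cob_smul] at this ⊢

lemma MinCut.tight (hgen : Subgroup.closure (Set.range f) = ⊤) {p q : Ultrafilter G} {D : Set G}
    (h : MinCut f k p q D) : Tight f D := by
  apply tight_of_minimal hgen (P := fun E => E ∈ p ∧ E ∉ q) h.finite
    (fun E hE => h.min E hE.1 hE.2)
  intro U _
  have hp := h.mem
  have hq := h.notMem
  have key : ∀ (r : Ultrafilter G), symmDiff U D ∈ r ↔ ¬ (U ∈ r ↔ D ∈ r) := by
    intro r
    rw [Set.symmDiff_def, Ultrafilter.union_mem_iff, Set.sdiff_eq, Set.sdiff_eq,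
      ← Ultrafilter.mem_coe, ← Ultrafilter.mem_coe,
      Filter.inter_mem_iff, Filter.inter_mem_iff]
    simp only [Ultrafilter.mem_coe, Ultrafilter.compl_mem_iff_notMem]
    tauto
  simp only [Ultrafilter.compl_mem_iff_notMem, key]
  tauto

lemma minCuts_subset (hgen : Subgroup.closure (Set.range f) = ⊤) :
    minCuts f k ⊆ TightCut f k := by
  rintro D ⟨p, q, h⟩
  exact ⟨h.tight hgen, h.finite, h.le, Ultrafilter.nonempty_of_mem h.mem,
    Ultrafilter.nonempty_of_mem h.compl.mem⟩

lemma smul_mem_minCuts {D : Set G} (g : G) : g • D ∈ minCuts f k ↔ D ∈ minCuts f k := by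
  constructor
  · rintro ⟨p, q, h⟩
    exact ⟨_, _, by simpa using h.smul g⁻¹⟩
  · rintro ⟨p, q, h⟩
    exact ⟨_, _, h.smul g⟩

/-- The minimal cuts crossing a given set. -/
def crossing (f : X → G) (k : ℕ) (D : Set G) : Set (Set G) :=
  {E | E ∈ minCuts f k ∧ ¬ Nested D E}

lemma finite_crossing_minCuts (hgen : Subgroup.closure (Set.range f) = ⊤) {D : Set G}
    (hD : (cob f D).Finite) : (crossing f k D).Finite :=
  (finite_crossing hD).subset fun _ h => ⟨minCuts_subset hgen h.1, h.2⟩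

lemma crossing_compl (D : Set G) : crossing f k Dᶜ = crossing f k D := by
  ext E
  simp only [crossing, Set.mem_ofPred_eq, nested_compl_left]

lemma crossing_smul (g : G) (D : Set G) : crossing f k (g • D) = g • crossing f k D := by
  ext E
  rw [Set.mem_smul_set_iff_inv_smul_mem]
  simp only [crossing, Set.mem_ofPred_eq, smul_mem_minCuts]
  rw [← nested_smul g⁻¹, inv_smul_smul]

lemma ncard_crossing_smul (g : G) (D : Set G) :
    (crossing f k (g • D)).ncard = (crossing f k D).ncard := by
  rw [crossing_smul, Set.ncard_smul_set]

lemma ncard_crossing_corners (hgen : Subgroup.closure (Set.range f) = ⊤) {C D : Set G}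
    (hC : C ∈ minCuts f k) (hCf : (cob f C).Finite) (hDf : (cob f D).Finite)
    (hCD : ¬ Nested C D) :
    (crossing f k (C ∩ D)).ncard + (crossing f k (Cᶜ ∩ Dᶜ)).ncard <
      (crossing f k C).ncard + (crossing f k D).ncard := by
  have f1 := finite_crossing_minCuts (k := k) hgen (finite_cob_inter hCf hDf)
  have f2 := finite_crossing_minCuts (k := k) hgen
    (finite_cob_inter (f := f) (C := Cᶜ) (D := Dᶜ) (by simpa) (by simpa))
  have f3 := finite_crossing_minCuts (k := k) hgen hCf
  have f4 := finite_crossing_minCuts (k := k) hgen hDf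
  rw [← Set.ncard_union_add_ncard_inter _ _ f1 f2, ← Set.ncard_union_add_ncard_inter _ _ f3 f4]
  have hi : crossing f k (C ∩ D) ∩ crossing f k (Cᶜ ∩ Dᶜ) ⊆ crossing f k C ∩ crossing f k D := by
    rintro E ⟨⟨h1, h2⟩, -, h3⟩
    refine ⟨⟨h1, fun h => ?_⟩, h1, fun h => ?_⟩
    all_goals
      unfold Nested at h h2 h3
      simp only [Set.compl_inter, compl_compl, Set.union_subset_iff] at h2 h3
      push Not at h2 h3
      rcases h with h | h | h | h
    · exact h2.1 (Set.inter_subset_left.trans h)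
    · exact h2.2.1 (Set.inter_subset_left.trans h)
    · exact h3.1 (Set.inter_subset_left.trans h)
    · exact h3.2.1 (Set.inter_subset_left.trans h)
    · exact h2.1 (Set.inter_subset_right.trans h)
    · exact h2.2.1 (Set.inter_subset_right.trans h)
    · exact h3.1 (Set.inter_subset_right.trans h)
    · exact h3.2.1 (Set.inter_subset_right.trans h)
  have hu : crossing f k (C ∩ D) ∪ crossing f k (Cᶜ ∩ Dᶜ) ⊂ crossing f k C ∪ crossing f k D := by
    rw [Set.ssubset_iff_of_subset]
    · refine ⟨C, Or.inr ⟨hC, fun h => hCD h.symm⟩, ?_⟩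
      rintro (⟨-, h⟩ | ⟨-, h⟩)
      · exact h (Or.inl Set.inter_subset_left)
      · exact h (Or.inr (Or.inl Set.inter_subset_left))
    · intro E hE
      by_contra hc
      simp only [crossing, Set.mem_union, Set.mem_ofPred_eq] at hE hc
      have hEm : E ∈ minCuts f k := by tauto
      have h1 : Nested C E := by_contra fun h => hc (Or.inl ⟨hEm, h⟩)
      have h2 : Nested D E := by_contra fun h => hc (Or.inr ⟨hEm, h⟩)
      rcases hE with h | h
      · exact h.2 (h1.inter h2 hCD)
      · refine h.2 ((nested_compl_left.mpr h1).inter (nested_compl_left.mpr h2) ?_)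
        rwa [nested_compl_left, nested_compl_right]
  have := Set.ncard_lt_ncard hu (f3.union f4)
  have := Set.ncard_le_ncard hi (f3.inter_of_left _)
  omega

/-- A minimal cut crossing as few minimal cuts as possible among those separating the same pair. -/
def OptimalCut (f : X → G) (k : ℕ) (p q : Ultrafilter G) (D : Set G) : Prop :=
  MinCut f k p q D ∧ ∀ E, MinCut f k p q E → (crossing f k D).ncard ≤ (crossing f k E).ncard

lemma OptimalCut.compl {p q : Ultrafilter G} {D : Set G} (h : OptimalCut f k p q D) :
    OptimalCut f k q p Dᶜ := by
  refine ⟨h.1.compl, fun E hE => ?_⟩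
  have := h.2 _ hE.compl
  rwa [crossing_compl] at this ⊢

lemma OptimalCut.smul {p q : Ultrafilter G} {D : Set G} (h : OptimalCut f k p q D) (g : G) :
    OptimalCut f k (p.map (g • ·)) (q.map (g • ·)) (g • D) := by
  refine ⟨h.1.smul g, fun E hE => ?_⟩
  have := h.2 _ (by simpa using hE.smul g⁻¹)
  rwa [ncard_crossing_smul] at this ⊢

/-- The family of optimal cuts. -/
def optimalCuts (f : X → G) (k : ℕ) : Set (Set G) := {D | ∃ p q, OptimalCut f k p q D}

lemma optimalCuts_subset (hgen : Subgroup.closure (Set.range f) = ⊤) :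
    optimalCuts f k ⊆ TightCut f k := fun _ ⟨p, q, h⟩ => minCuts_subset hgen ⟨p, q, h.1⟩

lemma compl_mem_optimalCuts {D : Set G} (h : D ∈ optimalCuts f k) : Dᶜ ∈ optimalCuts f k := by
  obtain ⟨p, q, h⟩ := h
  exact ⟨_, _, h.compl⟩

lemma smul_mem_optimalCuts {D : Set G} (g : G) :
    g • D ∈ optimalCuts f k ↔ D ∈ optimalCuts f k := by
  constructor
  · rintro ⟨p, q, h⟩
    exact ⟨_, _, by simpa using h.smul g⁻¹⟩
  · rintro ⟨p, q, h⟩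
    exact ⟨_, _, h.smul g⟩

lemma exists_optimalCut {p q : Ultrafilter G} {D : Set G} (hp : D ∈ p) (hq : D ∉ q)
    (hD : (cob f D).Finite) (hk : (cob f D).ncard ≤ k) : ∃ E, OptimalCut f k p q E := by
  have h1 : ∃ E, MinCut f k p q E := by
    obtain ⟨E, ⟨h1, h2, h3⟩, h4⟩ := exists_minimalFor_of_wellFoundedLT
      (fun E => E ∈ p ∧ E ∉ q ∧ (cob f E).Finite) (fun E => (cob f E).ncard) ⟨D, hp, hq, hD⟩
    have hmin : ∀ E', E' ∈ p → E' ∉ q → (cob f E').Finite →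
        (cob f E).ncard ≤ (cob f E').ncard := fun E' h1 h2 h3 =>
      (le_total _ _).elim id (fun h => h4 ⟨h1, h2, h3⟩ h)
    exact ⟨E, h1, h2, h3, (hmin D hp hq hD).trans hk, hmin⟩
  obtain ⟨E, h2, h3⟩ := exists_minimalFor_of_wellFoundedLT
    (fun E => MinCut f k p q E) (fun E => (crossing f k E).ncard) h1
  exact ⟨E, h2, fun E' hE' => (le_total _ _).elim id (fun h => h3 hE' h)⟩

/-- `E` separates `p` and `q`, in any order. -/
def Sep (p q : Ultrafilter G) (E : Set G) : Prop := ¬ (E ∈ p ↔ E ∈ q)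

lemma MinCut.ncard_le_of_sep {p q : Ultrafilter G} {D E : Set G} (h : MinCut f k p q D)
    (hE : Sep p q E) (hf : (cob f E).Finite) : (cob f D).ncard ≤ (cob f E).ncard := by
  by_cases hp : E ∈ p
  · exact h.min E hp (fun hq => hE ⟨fun _ => hq, fun _ => hp⟩) hf
  · have hq : E ∈ q := by unfold Sep at hE; tauto
    have := h.min Eᶜ (Ultrafilter.compl_mem_iff_notMem.mpr hp)
      (fun hc => Ultrafilter.compl_mem_iff_notMem.mp hc hq) (by simpa using hf)
    simpa using this

lemma OptimalCut.ncard_crossing_le_of_sep {p q : Ultrafilter G} {D E : Set G}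
    (h : OptimalCut f k p q D) (hE : Sep p q E) (hf : (cob f E).Finite)
    (hle : (cob f E).ncard ≤ (cob f D).ncard) :
    (crossing f k D).ncard ≤ (crossing f k E).ncard := by
  have hmin : ∀ E', E' ∈ p → E' ∉ q → (cob f E').Finite →
      (cob f E).ncard ≤ (cob f E').ncard := fun E' h1 h2 h3 => hle.trans (h.1.min E' h1 h2 h3)
  by_cases hp : E ∈ p
  · exact h.2 E ⟨hp, fun hq => hE ⟨fun _ => hq, fun _ => hp⟩, hf, hle.trans h.1.le, hmin⟩
  · have hq : E ∈ q := by unfold Sep at hE; tauto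
    rw [← crossing_compl E]
    exact h.2 Eᶜ ⟨Ultrafilter.compl_mem_iff_notMem.mpr hp,
      fun hc => Ultrafilter.compl_mem_iff_notMem.mp hc hq, by simpa using hf,
      by simpa using hle.trans h.1.le, by simpa using hmin⟩

section Corners

variable {p q r s : Ultrafilter G} {C D : Set G}

/-- Opposite corners of crossing optimal cuts cannot separate both pairs. -/
lemma OptimalCut.false_of_sep_corners (hgen : Subgroup.closure (Set.range f) = ⊤)
    (hC : OptimalCut f k p q C) (hD : OptimalCut f k r s D) (hCD : ¬ Nested C D) :
    ¬ (Sep p q (C ∩ D) ∧ Sep r s (Cᶜ ∩ Dᶜ)) ∧ ¬ (Sep p q (Cᶜ ∩ Dᶜ) ∧ Sep r s (C ∩ D)) := by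
  have f1 := finite_cob_inter hC.1.finite hD.1.finite
  have f2 := finite_cob_inter (f := f) (C := Cᶜ) (D := Dᶜ) (by simpa using hC.1.finite)
    (by simpa using hD.1.finite)
  have h1 := ncard_crossing_corners (k := k) hgen ⟨p, q, hC.1⟩ hC.1.finite hD.1.finite hCD
  have h2 := ncard_cob_corners hC.1.finite hD.1.finite
  constructor
  · rintro ⟨hp, hr⟩
    have h3 := hC.1.ncard_le_of_sep hp f1
    have h4 := hD.1.ncard_le_of_sep hr f2
    have h5 := hC.ncard_crossing_le_of_sep hp f1 (by omega)
    have h6 := hD.ncard_crossing_le_of_sep hr f2 (by omega)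
    omega
  · rintro ⟨hp, hr⟩
    have h3 := hC.1.ncard_le_of_sep hp f2
    have h4 := hD.1.ncard_le_of_sep hr f1
    have h5 := hC.ncard_crossing_le_of_sep hp f2 (by omega)
    have h6 := hD.ncard_crossing_le_of_sep hr f1 (by omega)
    omega

/-- Optimal cuts for crossing pairs are nested. -/
lemma OptimalCut.nested_of_diagonal (hgen : Subgroup.closure (Set.range f) = ⊤)
    (hC : OptimalCut f k p q C) (hD : OptimalCut f k r s D)
    (hp : D ∈ p) (hq : D ∉ q) (hr : C ∉ r) (hs : C ∈ s) : Nested C D := by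
  by_contra hCD
  have hp' := hC.1.mem
  have hq' := hC.1.notMem
  have hr' := hD.1.mem
  have hs' := hD.1.notMem
  have f1 := finite_cob_inter hC.1.finite hD.1.finite
  have f2 := finite_cob_inter (f := f) (C := Cᶜ) (D := Dᶜ) (by simpa using hC.1.finite)
    (by simpa using hD.1.finite)
  have h1 := ncard_crossing_corners (k := k) hgen ⟨p, q, hC.1⟩ hC.1.finite hD.1.finite hCD
  have h2 := ncard_cob_corners hC.1.finite hD.1.finite
  have e1 := hC.1.ncard_le_of_sep (E := D) (by unfold Sep; tauto) hD.1.finite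
  have e2 := hD.1.ncard_le_of_sep (E := C) (by unfold Sep; tauto) hC.1.finite
  have s1 : Sep p q (C ∩ D) := by
    simp only [Sep, inter_mem_ultrafilter]
    tauto
  have s2 : Sep p q (Cᶜ ∩ Dᶜ) := by
    simp only [Sep, inter_mem_ultrafilter, Ultrafilter.compl_mem_iff_notMem]
    tauto
  have e3 := hC.1.ncard_le_of_sep s1 f1
  have e4 := hC.1.ncard_le_of_sep s2 f2
  have m1 := hC.ncard_crossing_le_of_sep s1 f1 (by omega)
  have m2 := hC.ncard_crossing_le_of_sep s2 f2 (by omega)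
  have m3 := hD.ncard_crossing_le_of_sep (E := C) (by unfold Sep; tauto) hC.1.finite (by omega)
  omega

lemma OptimalCut.nested (hgen : Subgroup.closure (Set.range f) = ⊤)
    (hC : OptimalCut f k p q C) (hD : OptimalCut f k r s D) : Nested C D := by
  by_contra hCD
  have hCD' : ¬ Nested C Dᶜ := by rwa [nested_compl_right]
  obtain ⟨a1, a2⟩ := hC.false_of_sep_corners hgen hD hCD
  obtain ⟨b1, b2⟩ := hC.false_of_sep_corners hgen hD.compl hCD'
  have hp' := hC.1.mem
  have hq' := hC.1.notMem
  have hr' := hD.1.mem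
  have hs' := hD.1.notMem
  have c1 : ¬ (D ∈ p ∧ D ∉ q ∧ C ∉ r ∧ C ∈ s) := fun ⟨h1, h2, h3, h4⟩ =>
    hCD (hC.nested_of_diagonal hgen hD h1 h2 h3 h4)
  have c2 : ¬ (Dᶜ ∈ p ∧ Dᶜ ∉ q ∧ C ∉ s ∧ C ∈ r) := fun ⟨h1, h2, h3, h4⟩ =>
    hCD' (hC.nested_of_diagonal hgen hD.compl h1 h2 h3 h4)
  simp only [Sep, inter_mem_ultrafilter, Ultrafilter.compl_mem_iff_notMem] at *
  by_cases hP : D ∈ p <;> by_cases hQ : D ∈ q <;> by_cases hR : C ∈ r <;> by_cases hS : C ∈ s <;>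
    simp_all

lemma nested_of_mem_optimalCuts (hgen : Subgroup.closure (Set.range f) = ⊤)
    (hC : C ∈ optimalCuts f k) (hD : D ∈ optimalCuts f k) : Nested C D := by
  obtain ⟨p, q, hC⟩ := hC
  obtain ⟨r, s, hD⟩ := hD
  exact hC.nested hgen hD

end Corners

end OptimalCuts

section Grammar

/-- `Gen g s w` states that the sentential form `s` generates the word `w`. -/
inductive Gen {T : Type} (g : ContextFreeGrammar T) : List (Symbol T g.NT) → List T → Prop
  | nil : Gen g [] []
  | terminal (t : T) {s : List (Symbol T g.NT)} {w : List T} :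
      Gen g s w → Gen g (Symbol.terminal t :: s) (t :: w)
  | nonterminal {r : ContextFreeRule T g.NT} {s : List (Symbol T g.NT)} {u v : List T} :
      r ∈ g.rules → Gen g r.output u → Gen g s v →
        Gen g (Symbol.nonterminal r.input :: s) (u ++ v)

variable {T : Type} {g : ContextFreeGrammar T}

lemma Gen.append {s s' : List (Symbol T g.NT)} {u v : List T} (h : Gen g s u) (h' : Gen g s' v) :
    Gen g (s ++ s') (u ++ v) := by
  induction h with
  | nil => exact h'
  | terminal t _ ih => exact ih.terminal t
  | nonterminal hr h1 _ _ ih =>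
    rw [List.append_assoc]
    exact Gen.nonterminal hr h1 ih

lemma Gen.split {s s' : List (Symbol T g.NT)} {w : List T} (h : Gen g (s ++ s') w) :
    ∃ u v, w = u ++ v ∧ Gen g s u ∧ Gen g s' v := by
  induction s generalizing w with
  | nil => exact ⟨[], w, rfl, Gen.nil, h⟩
  | cons a s ih =>
    rw [List.cons_append] at h
    cases h with
    | terminal t h =>
      obtain ⟨u, v, rfl, h1, h2⟩ := ih h
      exact ⟨t :: u, v, rfl, h1.terminal t, h2⟩
    | nonterminal hr h0 h =>
      obtain ⟨u, v, rfl, h1, h2⟩ := ih h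
      exact ⟨_ ++ u, v, (List.append_assoc _ _ _).symm, Gen.nonterminal hr h0 h1, h2⟩

lemma gen_terminals (w : List T) : Gen g (w.map Symbol.terminal) w := by
  induction w with
  | nil => exact Gen.nil
  | cons t w ih => exact ih.terminal t

lemma gen_iff_derives {s : List (Symbol T g.NT)} {w : List T} :
    Gen g s w ↔ g.Derives s (w.map Symbol.terminal) := by
  constructor
  · intro h
    induction h with
    | nil => rfl
    | terminal t _ ih => exact ih.append_left [Symbol.terminal t]
    | @nonterminal r s u v hr _ _ ih1 ih2 =>
      have h1 : g.Produces (Symbol.nonterminal r.input :: s) (r.output ++ s) :=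
        ⟨r, hr, ContextFreeRule.Rewrites.head s⟩
      rw [List.map_append]
      exact h1.trans_derives ((ih1.append_right s).trans (ih2.append_left _))
  · intro h
    induction h using Relation.ReflTransGen.head_induction_on with
    | refl => exact gen_terminals w
    | head h _ ih =>
      obtain ⟨r, hr, hrw⟩ := h
      obtain ⟨p, q, rfl, rfl⟩ := hrw.exists_parts
      obtain ⟨u, v, rfl, h1, h2⟩ := ih.split
      obtain ⟨u1, u2, rfl, h3, h4⟩ := h1.split
      have := Gen.nonterminal hr h4 Gen.nil
      rw [List.append_nil] at this
      exact (h3.append this).append h2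

end Grammar

section Triangulation

variable {X G : Type} [Group G] (f : X → G)

/-- The value of a word in the group. -/
def val (w : List (X ⊕ X)) : G := wordProblemHom f (FreeMonoid.ofList w)

@[simp] lemma val_nil : val f [] = 1 := map_one _

@[simp] lemma val_append (u v : List (X ⊕ X)) : val f (u ++ v) = val f u * val f v := by
  simp [val]

lemma val_cons (a : X ⊕ X) (v : List (X ⊕ X)) : val f (a :: v) = val f [a] * val f v :=
  val_append f [a] v

@[simp] lemma val_inl (x : X) : val f [Sum.inl x] = f x := by
  simp [val, wordProblemHom]

@[simp] lemma val_inr (x : X) : val f [Sum.inr x] = (f x)⁻¹ := by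
  simp [val, wordProblemHom]

lemma mem_wordProblem {w : List (X ⊕ X)} : w ∈ wordProblem f ↔ val f w = 1 := Iff.rfl

lemma exists_val_inv (w : List (X ⊕ X)) : ∃ w', w'.length = w.length ∧ val f w' = (val f w)⁻¹ := by
  induction w with
  | nil => exact ⟨[], rfl, by simp⟩
  | cons a w ih =>
    obtain ⟨w', h1, h2⟩ := ih
    refine ⟨w' ++ [a.swap], by simp [h1], ?_⟩
    rw [val_append, h2, val_cons f a w, mul_inv_rev]
    cases a <;> simp

variable {f}

lemma exists_val (hgen : Subgroup.closure (Set.range f) = ⊤) (g : G) : ∃ w, val f w = g := by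
  have hg : g ∈ Subgroup.closure (Set.range f) := by rw [hgen]; trivial
  induction hg using Subgroup.closure_induction with
  | mem y hy =>
    obtain ⟨x, rfl⟩ := hy
    exact ⟨[Sum.inl x], by simp⟩
  | one => exact ⟨[], by simp⟩
  | mul a b _ _ iha ihb =>
    obtain ⟨u, rfl⟩ := iha
    obtain ⟨v, rfl⟩ := ihb
    exact ⟨u ++ v, by simp⟩
  | inv a _ iha =>
    obtain ⟨u, rfl⟩ := iha
    obtain ⟨w, -, h⟩ := exists_val_inv f u
    exact ⟨w, h⟩

/-- Suffixes of the right-hand sides of the rules and of the initial form. -/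
def forms {T : Type} (g : ContextFreeGrammar T) : Set (List (Symbol T g.NT)) :=
  {s | ∃ l ∈ insert [Symbol.nonterminal g.initial] (ContextFreeRule.output '' (g.rules : Set _)),
    s <:+ l}

lemma finite_forms {T : Type} (g : ContextFreeGrammar T) : (forms g).Finite := by
  have : (⋃ l ∈ insert [Symbol.nonterminal g.initial]
      (ContextFreeRule.output '' (g.rules : Set (ContextFreeRule T g.NT))),
      {s | s <:+ l}).Finite := by
    refine Set.Finite.biUnion ((g.rules.finite_toSet.image _).insert _) fun l _ => ?_
    refine l.tails.finite_toSet.subset fun s hs => ?_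
    simpa using hs
  refine this.subset ?_
  rintro s ⟨l, h1, h2⟩
  simp only [Set.mem_iUnion]
  exact ⟨l, h1, h2⟩

lemma forms_tail {T : Type} {g : ContextFreeGrammar T} {a : Symbol T g.NT}
    {s : List (Symbol T g.NT)} (h : a :: s ∈ forms g) : s ∈ forms g := by
  obtain ⟨l, h1, h2⟩ := h
  exact ⟨l, h1, (List.suffix_cons a s).trans h2⟩

lemma forms_output {T : Type} {g : ContextFreeGrammar T} {r : ContextFreeRule T g.NT}
    (h : r ∈ g.rules) : r.output ∈ forms g :=
  ⟨_, Or.inr ⟨r, h, rfl⟩, List.suffix_refl _⟩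

variable (f) in
/-- A sentential form is useful if it occurs in a context all of whose completions represent the
identity. -/
def Useful (g : ContextFreeGrammar (X ⊕ X)) (s : List (Symbol (X ⊕ X) g.NT)) : Prop :=
  ∃ x y, ∀ w, Gen g s w → val f (x ++ w ++ y) = 1

variable {g : ContextFreeGrammar (X ⊕ X)}

lemma Useful.val_eq {s : List (Symbol (X ⊕ X) g.NT)} (h : Useful f g s) {u v : List (X ⊕ X)}
    (hu : Gen g s u) (hv : Gen g s v) : val f u = val f v := by
  obtain ⟨x, y, h⟩ := h
  have := (h u hu).trans (h v hv).symm
  simpa using this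

variable (f g) in
/-- The values of words generated by useful forms, and of letters. -/
def values : Set G :=
  Set.range (fun a : X ⊕ X => val f [a]) ∪
    {b | ∃ s ∈ forms g, Useful f g s ∧ ∃ w, Gen g s w ∧ val f w = b}

lemma finite_values [Finite X] : (values f g).Finite := by
  refine (Set.finite_range _).union ?_
  have : (⋃ s ∈ forms g, {b | Useful f g s ∧ ∃ w, Gen g s w ∧ val f w = b}).Finite := by
    refine (finite_forms g).biUnion fun s _ => Set.Subsingleton.finite ?_
    rintro _ ⟨h, u, hu, rfl⟩ _ ⟨-, v, hv, rfl⟩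
    exact h.val_eq hu hv
  refine this.subset ?_
  rintro b ⟨s, h1, h2⟩
  simp only [Set.mem_iUnion]
  exact ⟨s, h1, h2⟩

lemma Gen.exists_triangle {s : List (Symbol (X ⊕ X) g.NT)} {w : List (X ⊕ X)} (h : Gen g s w)
    (hs : s ∈ forms g) (hu : Useful f g s) (u₁ u₂ u₃ : List (X ⊕ X)) (hw : w = u₁ ++ (u₂ ++ u₃))
    (h2 : 2 ≤ u₂.length) :
    ∃ p p' q q' t t', u₁ = p ++ p' ∧ u₂ = q ++ q' ∧ u₃ = t ++ t' ∧
      val f (p' ++ q) ∈ values f g ∧ val f (q' ++ t) ∈ values f g := by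
  induction h generalizing u₁ u₂ u₃ with
  | nil =>
    have := congrArg List.length hw
    simp at this
    omega
  | @terminal a s w h ih =>
    have hu' : Useful f g s := by
      obtain ⟨x, y, hxy⟩ := hu
      refine ⟨x ++ [a], y, fun w hw => ?_⟩
      have := hxy _ (hw.terminal a)
      rwa [List.append_assoc x, List.singleton_append]
    cases u₁ with
    | nil =>
      cases u₂ with
      | nil => simp at h2
      | cons b u₂ =>
        simp only [List.nil_append, List.cons_append, List.cons.injEq] at hw
        obtain ⟨rfl, rfl⟩ := hw
        refine ⟨[], [], [a], u₂, u₃, [], rfl, rfl, by simp, Or.inl ⟨a, rfl⟩,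
          Or.inr ⟨s, forms_tail hs, hu', _, h, rfl⟩⟩
    | cons b u₁ =>
      simp only [List.cons_append, List.cons.injEq] at hw
      obtain ⟨rfl, rfl⟩ := hw
      obtain ⟨p, p', q, q', t, t', rfl, rfl, rfl, h1, h2⟩ :=
        ih (forms_tail hs) hu' u₁ u₂ u₃ rfl h2
      exact ⟨a :: p, p', q, q', t, t', rfl, rfl, rfl, h1, h2⟩
  | @nonterminal r s u v hr h h' ih ih' =>
    have hu1 : Useful f g r.output := by
      obtain ⟨x, y, hxy⟩ := hu
      refine ⟨x, v ++ y, fun w hw => ?_⟩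
      have := hxy _ (Gen.nonterminal hr hw h')
      simpa [mul_assoc] using this
    have hu2 : Useful f g s := by
      obtain ⟨x, y, hxy⟩ := hu
      refine ⟨x ++ u, y, fun w hw => ?_⟩
      have := hxy _ (Gen.nonterminal hr h hw)
      simpa [mul_assoc] using this
    rw [List.append_eq_append_iff] at hw
    rcases hw with ⟨a, rfl, rfl⟩ | ⟨a, rfl, hw⟩
    · obtain ⟨p, p', q, q', t, t', rfl, rfl, rfl, h1, h2⟩ :=
        ih' (forms_tail hs) hu2 a u₂ u₃ rfl h2
      exact ⟨u ++ p, p', q, q', t, t', (List.append_assoc _ _ _).symm, rfl, rfl, h1, h2⟩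
    · symm at hw
      rw [List.append_eq_append_iff] at hw
      rcases hw with ⟨b, rfl, rfl⟩ | ⟨b, rfl, rfl⟩
      · exact ⟨[], u₁, a, b, u₃, [], rfl, rfl, by simp,
          Or.inr ⟨_, forms_output hr, hu1, _, h, rfl⟩, Or.inr ⟨_, forms_tail hs, hu2, _, h', rfl⟩⟩
      · obtain ⟨p, p', q, q', t, t', rfl, rfl, rfl, h1, h2⟩ :=
          ih (forms_output hr) hu1 u₁ u₂ b rfl h2
        exact ⟨p, p', q, q', t, t' ++ v, rfl, rfl, by simp, h1, h2⟩

theorem exists_triangles [Finite X] (h : (wordProblem f).IsContextFree) :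
    ∃ B : Set G, B.Finite ∧ ∀ u₁ u₂ u₃ : List (X ⊕ X), val f (u₁ ++ (u₂ ++ u₃)) = 1 →
      2 ≤ u₂.length → ∃ p p' q q' t t', u₁ = p ++ p' ∧ u₂ = q ++ q' ∧ u₃ = t ++ t' ∧
        val f (p' ++ q) ∈ B ∧ val f (q' ++ t) ∈ B := by
  obtain ⟨g, hg⟩ := h
  have key : ∀ w, Gen g [Symbol.nonterminal g.initial] w ↔ val f w = 1 := by
    intro w
    rw [gen_iff_derives, ← mem_wordProblem, ← hg, ContextFreeGrammar.mem_language_iff]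
  refine ⟨values f g, finite_values, fun u₁ u₂ u₃ hw h2 => ?_⟩
  refine ((key _).mpr hw).exists_triangle ⟨_, Or.inl rfl, List.suffix_refl _⟩ ?_ u₁ u₂ u₃ rfl h2
  exact ⟨[], [], fun w hw => by simpa using (key w).mp hw⟩

end Triangulation

section Ball

variable {X G : Type} [Group G] (f : X → G)

/-- The elements represented by a word of length at most `n`. -/
def ball (n : ℕ) : Set G := {g | ∃ w, w.length ≤ n ∧ val f w = g}

variable {f}

lemma one_mem_ball (n : ℕ) : 1 ∈ ball f n := ⟨[], Nat.zero_le n, val_nil f⟩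

lemma val_mem_ball {n : ℕ} {w : List (X ⊕ X)} (h : w.length ≤ n) : val f w ∈ ball f n := ⟨w, h, rfl⟩

lemma ball_mono {m n : ℕ} (h : m ≤ n) : ball f m ⊆ ball f n := by
  rintro _ ⟨w, hw, rfl⟩
  exact val_mem_ball (hw.trans h)

lemma inv_mem_ball {n : ℕ} {g : G} (h : g ∈ ball f n) : g⁻¹ ∈ ball f n := by
  obtain ⟨w, hw, rfl⟩ := h
  obtain ⟨w', h1, h2⟩ := exists_val_inv f w
  exact ⟨w', h1.trans_le hw, h2⟩

lemma mul_mem_ball {m n : ℕ} {g h : G} (hg : g ∈ ball f m) (hh : h ∈ ball f n) :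
    g * h ∈ ball f (m + n) := by
  obtain ⟨u, hu, rfl⟩ := hg
  obtain ⟨v, hv, rfl⟩ := hh
  rw [← val_append]
  exact val_mem_ball (by rw [List.length_append]; omega)

lemma finite_ball [Finite X] (n : ℕ) : (ball f n).Finite := by
  refine ((List.finite_length_le (X ⊕ X) n).image (val f)).subset ?_
  rintro _ ⟨w, hw, rfl⟩
  exact ⟨w, hw, rfl⟩

lemma exists_subset_ball (hgen : Subgroup.closure (Set.range f) = ⊤) {S : Set G} (hS : S.Finite) :
    ∃ n, S ⊆ ball f n := by
  induction S, hS using Set.Finite.induction_on with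
  | empty => exact ⟨0, Set.empty_subset _⟩
  | @insert a S _ _ ih =>
    obtain ⟨n, hn⟩ := ih
    obtain ⟨w, rfl⟩ := exists_val hgen a
    refine ⟨max n w.length, Set.insert_subset (val_mem_ball (le_max_right _ _)) ?_⟩
    exact hn.trans (ball_mono (le_max_left _ _))

variable (f) in
/-- A word of minimal length among those representing its value. -/
def Geodesic (w : List (X ⊕ X)) : Prop := ∀ v, val f v = val f w → w.length ≤ v.length

lemma exists_geodesic (hgen : Subgroup.closure (Set.range f) = ⊤) (g : G) :
    ∃ w, Geodesic f w ∧ val f w = g := by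
  classical
  obtain ⟨w, hw⟩ := exists_val hgen g
  have hex : ∃ n, ∃ w, w.length = n ∧ val f w = g := ⟨_, w, rfl, hw⟩
  obtain ⟨v, h1, h2⟩ := Nat.find_spec hex
  refine ⟨v, fun u hu => ?_, h2⟩
  rw [h1]
  exact Nat.find_min' hex ⟨u, rfl, hu.trans h2⟩

lemma Geodesic.length_le {a b c : List (X ⊕ X)} {n : ℕ} (h : Geodesic f (a ++ (b ++ c)))
    (hb : val f b ∈ ball f n) : b.length ≤ n := by
  obtain ⟨v, hv, hvb⟩ := hb
  have := h (a ++ (v ++ c)) (by simp [hvb])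
  simp only [List.length_append] at this
  omega

lemma subset_or_disjoint_ball {U : Set G} {n : ℕ} (h : ∀ e ∈ cob f U, e.1 ∉ ball f n ∨
    e.1 * f e.2 ∉ ball f n) : ball f n ⊆ U ∨ Disjoint U (ball f n) := by
  have key : ∀ w : List (X ⊕ X), w.length ≤ n → (val f w ∈ U ↔ 1 ∈ U) := by
    intro w
    induction w using List.reverseRecOn with
    | nil => simp
    | append_singleton w a ih =>
      intro hw
      rw [← ih (by rw [List.length_append] at hw; omega)]
      have h1 : val f w ∈ ball f n := val_mem_ball (by rw [List.length_append] at hw; omega)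
      have h2 : val f (w ++ [a]) ∈ ball f n := val_mem_ball hw
      rw [val_append] at h2 ⊢
      cases a with
      | inl x =>
        by_contra hc
        rw [val_inl] at *
        rcases h (val f w, x) (fun h => hc h.symm) with h' | h'
        exacts [h' h1, h' h2]
      | inr x =>
        by_contra hc
        rw [val_inr] at *
        rcases h (val f w * (f x)⁻¹, x) (by simpa [mem_cob] using hc) with h' | h'
        · exact h' h2
        · exact h' (by simpa using h1)
  by_cases h1 : 1 ∈ U
  · left
    rintro _ ⟨w, hw, rfl⟩
    exact (key w hw).mpr h1
  · right
    rw [Set.disjoint_right]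
    rintro _ ⟨w, hw, rfl⟩
    exact fun hc => h1 ((key w hw).mp hc)

end Ball

section Bottleneck

variable {X G : Type} [Group G] (f : X → G)

/-- The elements from which every path to `F` visits `S`. -/
def shadow (F S : Set G) : Set G :=
  {y | ∀ t, y * val f t ∈ F → ∃ t', t' <+: t ∧ y * val f t' ∈ S}

variable {f}

lemma mem_shadow_mul {F S : Set G} {y : G} (h : y ∈ shadow f F S) (hy : y ∉ S) (a : X ⊕ X) :
    y * val f [a] ∈ shadow f F S := by
  intro t ht
  rw [mul_assoc, ← val_append] at ht
  obtain ⟨t', h1, h2⟩ := h _ ht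
  rw [List.singleton_append, List.prefix_cons_iff] at h1
  rcases h1 with rfl | ⟨s, rfl, h1⟩
  · simp [hy] at h2
  · refine ⟨s, h1, ?_⟩
    rwa [val_cons, ← mul_assoc] at h2

lemma cob_shadow_subset (F S : Set G) :
    cob f (shadow f F S) ⊆ {e | e.1 ∈ S ∨ e.1 * f e.2 ∈ S} := by
  rintro ⟨y, x⟩ h
  by_contra hc
  simp only [Set.mem_ofPred_eq, not_or] at hc
  refine h ⟨fun hy => ?_, fun hy => ?_⟩
  · simpa using mem_shadow_mul hy hc.1 (Sum.inl x)
  · simpa using mem_shadow_mul hy hc.2 (Sum.inr x)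

lemma shadow_inter_subset (F S : Set G) : shadow f F S ∩ F ⊆ S := by
  rintro y ⟨h1, h2⟩
  obtain ⟨t, h3, h4⟩ := h1 [] (by simpa using h2)
  rw [List.prefix_nil] at h3
  subst h3
  simpa using h4

/-- A context-free word problem yields, at every scale, boundedly small cuts separating a given
ball from a given nonprincipal ultrafilter. -/
lemma exists_cut_avoiding_ball [Finite X] (hgen : Subgroup.closure (Set.range f) = ⊤)
    (h : (wordProblem f).IsContextFree) : ∃ k, ∀ (n : ℕ) (p : Ultrafilter G),
      (∀ S : Set G, S.Finite → S ∉ p) →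
      ∃ D ∈ p, Disjoint D (ball f n) ∧ (cob f D).Finite ∧ (cob f D).ncard ≤ k := by
  obtain ⟨B, hBfin, hB⟩ := exists_triangles h
  obtain ⟨K, hK⟩ := exists_subset_ball hgen hBfin
  have hfin : (ball f (K + K + 1) ×ˢ (Set.univ : Set X)).Finite :=
    (finite_ball _).prod Set.finite_univ
  refine ⟨(ball f (K + K + 1) ×ˢ (Set.univ : Set X)).ncard, fun n p hp => ?_⟩
  set r := n + (K + K) + 1 with hr
  let M : Set G := {m | m ∈ ball f r ∧ m ∉ ball f (n + (K + K))}
  have hM : M.Finite := (finite_ball r).subset fun m hm => hm.1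
  have hcover : (ball f (r + 1))ᶜ ⊆ ⋃ m ∈ M, shadow f (ball f n) (m • ball f (K + K)) := by
    intro y hy
    obtain ⟨u, hu, rfl⟩ := exists_geodesic hgen y
    have hlen : r + 2 ≤ u.length := by
      by_contra hc
      exact hy (val_mem_ball (by omega))
    obtain ⟨u₁, u₂, rfl, h1⟩ : ∃ u₁ u₂, u = u₁ ++ u₂ ∧ u₁.length = r :=
      ⟨u.take r, u.drop r, (List.take_append_drop r u).symm, by rw [List.length_take]; omega⟩
    have hm : val f u₁ ∉ ball f (n + (K + K)) := by
      intro hm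
      have := Geodesic.length_le (a := []) hu hm
      omega
    simp only [Set.mem_iUnion]
    refine ⟨val f u₁, ⟨val_mem_ball h1.le, hm⟩, ?_⟩
    intro t ht
    obtain ⟨s, hs, hst⟩ := inv_mem_ball ht
    have hw : val f (u₁ ++ (u₂ ++ (t ++ s))) = 1 := by
      rw [val_append, val_append, val_append, hst, val_append]
      group
    rw [List.length_append] at hlen
    obtain ⟨p, p', q, q', t₁, t₂, rfl, rfl, h2, h3, h4⟩ := hB _ _ _ hw (by omega)
    have hq : (p' ++ q).length ≤ K := by
      refine Geodesic.length_le (a := p) (c := q') ?_ (hK h3)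
      simpa using hu
    rw [List.length_append] at hq
    have hc : (val f (p ++ p'))⁻¹ * (val f (p ++ p' ++ (q ++ q')) * val f t₁) ∈
        ball f (K + K) := by
      have : (val f (p ++ p'))⁻¹ * (val f (p ++ p' ++ (q ++ q')) * val f t₁) =
          val f q * val f (q' ++ t₁) := by
        simp only [val_append]
        group
      rw [this]
      exact mul_mem_ball (val_mem_ball (by omega)) (hK h4)
    rcases List.append_eq_append_iff.mp h2 with ⟨s₁, rfl, rfl⟩ | ⟨s₁, rfl, rfl⟩
    · exfalso
      apply hm
      have h5 : (val f (p ++ p' ++ (q ++ q')) * val f (t ++ s₁))⁻¹ = val f t₂ :=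
        inv_eq_of_mul_eq_one_right (by simpa [mul_assoc] using hw)
      have h6 := mul_mem_ball (inv_mem_ball (n := n) (val_mem_ball (w := t₂)
        (by rw [List.length_append] at hs; omega))) (inv_mem_ball hc)
      rwa [← h5, inv_inv, mul_inv_rev, inv_inv, mul_inv_cancel_left] at h6
    · refine ⟨t₁, List.prefix_append _ _, ?_⟩
      rwa [Set.mem_smul_set_iff_inv_smul_mem, smul_eq_mul]
  have hmem : (ball f (r + 1))ᶜ ∈ p := Ultrafilter.compl_mem_iff_notMem.mpr (hp _ (finite_ball _))
  obtain ⟨m, hm, hmp⟩ := (Ultrafilter.finite_biUnion_mem_iff hM).mp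
    (Filter.mem_of_superset hmem hcover)
  have hsub : cob f (shadow f (ball f n) (m • ball f (K + K))) ⊆
      (fun e : G × X => (m * e.1, e.2)) '' (ball f (K + K + 1) ×ˢ (Set.univ : Set X)) := by
    intro e he
    refine ⟨(m⁻¹ * e.1, e.2), ⟨?_, trivial⟩, by simp⟩
    rcases cob_shadow_subset _ _ he with h1 | h1 <;>
      rw [Set.mem_smul_set_iff_inv_smul_mem, smul_eq_mul] at h1
    · exact ball_mono (Nat.le_succ _) h1
    · have := mul_mem_ball h1 (inv_mem_ball (val_mem_ball (f := f) (w := [Sum.inl e.2]) le_rfl))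
      simpa [← mul_assoc] using this
  refine ⟨_, hmp, ?_, (hfin.image _).subset hsub, ?_⟩
  · rw [Set.disjoint_left]
    intro y h1 h2
    have h3 := shadow_inter_subset _ _ ⟨h1, h2⟩
    rw [Set.mem_smul_set_iff_inv_smul_mem, smul_eq_mul] at h3
    have := mul_mem_ball h2 (inv_mem_ball h3)
    exact hm.2 (by simpa using this)
  · exact (Set.ncard_le_ncard hsub (hfin.image _)).trans (Set.ncard_image_le hfin)

/-- The cuts of `exists_cut_avoiding_ball` can be chosen tight. -/
lemma exists_tightCut_avoiding_ball [Finite X] (hgen : Subgroup.closure (Set.range f) = ⊤)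
    (h : (wordProblem f).IsContextFree) : ∃ k, ∀ (n : ℕ) (p : Ultrafilter G),
      (∀ S : Set G, S.Finite → S ∉ p) → ∃ D ∈ p, Disjoint D (ball f n) ∧ D ∈ TightCut f k := by
  classical
  obtain ⟨k, hk⟩ := exists_cut_avoiding_ball hgen h
  refine ⟨k, fun n p hp => ?_⟩
  have hex : ∃ c, ∃ D ∈ p, Disjoint D (ball f n) ∧ (cob f D).Finite ∧ (cob f D).ncard = c := by
    obtain ⟨D, h1, h2, h3, -⟩ := hk n p hp
    exact ⟨_, D, h1, h2, h3, rfl⟩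
  obtain ⟨D, h1, h2, h3, h4⟩ := Nat.find_spec hex
  have hmin : ∀ E, (E ∈ p ∧ Disjoint E (ball f n)) → (cob f E).Finite →
      (cob f D).ncard ≤ (cob f E).ncard := by
    rintro E ⟨h5, h6⟩ h7
    rw [h4]
    exact Nat.find_min' hex ⟨E, h5, h6, h7, rfl⟩
  have hdisj : ∀ g ∈ ball f n, g ∉ D := fun g hg hc => Set.disjoint_left.mp h2 hc hg
  refine ⟨D, h1, h2, tight_of_minimal hgen h3 hmin ?_, h3, ?_, p.nonempty_of_mem h1,
    ⟨1, hdisj 1 (one_mem_ball n)⟩⟩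
  · intro U hU
    have hUb : ball f n ⊆ U ∨ Disjoint U (ball f n) := by
      refine subset_or_disjoint_ball fun e he => ?_
      by_contra hc
      push Not at hc
      exact hU he (iff_of_false (hdisj _ hc.1) (hdisj _ hc.2))
    rcases hUb with hUb | hUb
    · by_cases hp' : U ∈ p
      · right; right; right
        refine ⟨Filter.mem_of_superset (Filter.inter_mem hp' h1) ?_, ?_⟩
        · rintro g ⟨h5, h6⟩
          simp [h5, h6]
        · rw [Set.disjoint_right]
          intro g hg
          simp [hUb hg, hdisj g hg]
      · right; left
        exact ⟨Ultrafilter.compl_mem_iff_notMem.mpr hp',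
          Set.disjoint_left.mpr fun g hg hg' => hg (hUb hg')⟩
    · by_cases hp' : U ∈ p
      · exact Or.inl ⟨hp', hUb⟩
      · right; right; left
        refine ⟨Filter.mem_of_superset
          (Filter.inter_mem (Ultrafilter.compl_mem_iff_notMem.mpr hp') h1) ?_, ?_⟩
        · rintro g ⟨h5, h6⟩
          exact Or.inr ⟨h6, h5⟩
        · rw [Set.disjoint_right]
          intro g hg
          simp [Set.mem_symmDiff, Set.disjoint_right.mp hUb hg, hdisj g hg]
  · obtain ⟨E, h5, h6, h7, h8⟩ := hk n p hp
    exact (hmin E ⟨h5, h6⟩ h7).trans h8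

end Bottleneck

section Splitting

variable {X G : Type} [Group G] {f : X → G}

lemma pow_smul_subset {g : G} {D : Set G} (h : g • D ⊆ D) (n : ℕ) : g ^ n • D ⊆ D := by
  induction n with
  | zero => simp
  | succ n ih =>
    rw [pow_succ, mul_smul]
    exact (Set.smul_set_mono h).trans ih

lemma infinite_diff_of_smul_ssubset {Y : Subgroup G} {g : G} {D : Set G} (hg : g ∈ Y)
    (h : g • D ⊂ D) (h1 : 1 ∉ D) : ((Y : Set G) \ D).Infinite := by
  have hord : ¬ IsOfFinOrder g := by
    rw [isOfFinOrder_iff_pow_eq_one]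
    rintro ⟨n, hn, hgn⟩
    obtain ⟨m, rfl⟩ : ∃ m, n = m + 1 := ⟨n - 1, by omega⟩
    apply h.2
    calc D = g • g ^ m • D := by rw [← mul_smul, ← pow_succ', hgn, one_smul]
      _ ⊆ g • D := Set.smul_set_mono (pow_smul_subset h.1 m)
  have hinj : Function.Injective fun n : ℕ => g⁻¹ ^ n :=
    injective_pow_iff_not_isOfFinOrder.mpr (by rwa [isOfFinOrder_inv_iff])
  refine (Set.infinite_range_of_injective hinj).mono ?_
  rintro _ ⟨n, rfl⟩
  refine ⟨Y.pow_mem (Y.inv_mem hg) n, fun hc => h1 (pow_smul_subset h.1 n ?_)⟩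
  rw [Set.mem_smul_set_iff_inv_smul_mem]
  simpa using hc

/-- The elements moving the cut `D` to itself or to a cut crossing it. -/
def crossers (D : Set G) : Set G := {h | h • D = D ∨ ¬ Nested D (h • D)}

lemma crossers_subset_image (D : Set G) (g : G) :
    crossers D ⊆ (fun h => g⁻¹ * h * g) '' crossers (g • D) := by
  intro h hh
  refine ⟨g * h * g⁻¹, ?_, by group⟩
  have : (g * h * g⁻¹) • g • D = g • h • D := by simp [mul_smul]
  rw [crossers, Set.mem_ofPred_eq, this, nested_smul, smul_left_cancel_iff]
  exact hh

lemma finite_crossers (hgen : Subgroup.closure (Set.range f) = ⊤) {k : ℕ} {D : Set G}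
    (hD : D ∈ TightCut f k) : (crossers D).Finite := by
  have h1 : (⋃ E ∈ {E | E ∈ TightCut f k ∧ ¬ Nested D E}, {g : G | g • D = E}).Finite :=
    (finite_crossing hD.2.1).biUnion fun E _ => finite_smul_eq hgen hD E
  refine ((finite_smul_eq hgen hD D).union h1).subset ?_
  rintro g (hg | hg)
  · exact Or.inl hg
  · right
    simp only [Set.mem_iUnion]
    exact ⟨g • D, ⟨TightCut.smul hD g, hg⟩, rfl⟩

lemma exists_ncard_crossers_le [Finite X] (hgen : Subgroup.closure (Set.range f) = ⊤) (k : ℕ) :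
    ∃ L, ∀ D ∈ TightCut f k, (crossers D).ncard ≤ L := by
  obtain ⟨R, hR, hRk, hrep⟩ := exists_finite_orbit_representatives hgen k
  obtain ⟨L, hL⟩ := (hR.image fun D => (crossers D).ncard).bddAbove
  refine ⟨L, fun D hD => ?_⟩
  obtain ⟨g, hg⟩ := hrep D hD
  have hfin := finite_crossers hgen (hRk hg)
  exact (Set.ncard_le_ncard (crossers_subset_image D g) (hfin.image _)).trans
    ((Set.ncard_image_le hfin).trans (hL ⟨_, hg, rfl⟩))

lemma exists_nonprincipal {α : Type} {S : Set α} (hS : S.Infinite) :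
    ∃ p : Ultrafilter α, S ∈ p ∧ ∀ T : Set α, T.Finite → T ∉ p := by
  have := hS.cofinite_inf_principal_neBot
  refine ⟨Ultrafilter.of (Filter.cofinite ⊓ Filter.principal S), ?_, fun T hT => ?_⟩
  · exact Ultrafilter.of_le _ (Filter.mem_inf_of_right (Filter.mem_principal_self S))
  · rw [← Ultrafilter.compl_mem_iff_notMem]
    exact Ultrafilter.of_le _ (Filter.mem_inf_of_left hT.compl_mem_cofinite)

/-- If the word problem is context-free, then boundedly small cuts split all infinite subgroups. -/
theorem exists_splitting [Finite X] (hgen : Subgroup.closure (Set.range f) = ⊤)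
    (h : (wordProblem f).IsContextFree) : ∃ k, ∀ Y : Subgroup G, (Y : Set G).Infinite →
      ∃ D ∈ TightCut f k, ((Y : Set G) ∩ D).Infinite ∧ ((Y : Set G) \ D).Infinite := by
  classical
  obtain ⟨k, hk⟩ := exists_tightCut_avoiding_ball hgen h
  obtain ⟨L, hL⟩ := exists_ncard_crossers_le hgen k
  refine ⟨k, fun Y hY => ?_⟩
  by_contra hc
  push Not at hc
  obtain ⟨p, hYp, hp⟩ := exists_nonprincipal hY
  obtain ⟨s, hsY, hs⟩ := hY.exists_subset_card_eq (L + 1)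
  obtain ⟨n, hn⟩ := exists_subset_ball hgen s.finite_toSet
  obtain ⟨D, hDp, hDn, hD⟩ := hk n p hp
  have hDn := Set.disjoint_right.mp hDn
  have h1 : 1 ∉ D := hDn (one_mem_ball n)
  have hfin : ((Y : Set G) \ D).Finite :=
    Set.not_infinite.mp (by
      simpa using hc D hD fun hf => hp _ hf (Filter.inter_mem hYp hDp))
  have hsub : (s : Set G) ⊆ crossers D := by
    intro y hy
    have hyY := hsY hy
    have h1y : 1 ∉ y • D := by
      rw [Set.mem_smul_set_iff_inv_smul_mem, smul_eq_mul, mul_one]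
      exact hDn (inv_mem_ball (hn hy))
    by_contra hcr
    simp only [crossers, Set.mem_ofPred_eq, not_or, not_not] at hcr
    obtain ⟨hne, hnest⟩ := hcr
    have hfin' : ((Y : Set G) \ y • D).Finite := by
      refine (hfin.image fun g => y * g).subset ?_
      rintro g ⟨hg1, hg2⟩
      rw [Set.mem_smul_set_iff_inv_smul_mem] at hg2
      exact ⟨y⁻¹ * g, ⟨Y.mul_mem (Y.inv_mem hyY) hg1, hg2⟩, by simp⟩
    obtain ⟨z, hz1, hz2⟩ := (hY.sdiff (hfin.union hfin')).nonempty
    simp only [Set.mem_union, Set.mem_sdiff, not_or, not_and, not_not] at hz2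
    rcases hnest with hs' | hs' | hs' | hs'
    · refine infinite_diff_of_smul_ssubset (Y.inv_mem hyY) ?_ h1 hfin
      rw [Set.ssubset_iff_subset_ne]
      refine ⟨Set.smul_set_subset_iff_subset_inv_smul_set.mpr (by simpa using hs'), fun hc => ?_⟩
      exact hne (by rw [inv_smul_eq_iff] at hc; exact hc.symm)
    · exact hs' (hz2.1 hz1) (hz2.2 hz1)
    · exact h1y (hs' h1)
    · refine infinite_diff_of_smul_ssubset hyY ?_ h1 hfin
      exact Set.ssubset_iff_subset_ne.mpr ⟨Set.compl_subset_compl.mp hs', hne⟩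
  have h2 := (Set.ncard_le_ncard hsub (finite_crossers hgen hD)).trans (hL D hD)
  rw [Set.ncard_coe_finset, hs] at h2
  omega

end Splitting

/-- An action of `G` on a rooted tree with vertex set `V`, described by parents and depths. The
edges join the vertices `v ≠ root` to their parents; the action preserves edges but need not fix the
root. -/
structure RootedTree (G V : Type) [Group G] [MulAction G V] where
  /-- the root -/
  root : V
  /-- the parent of a vertex (irrelevant for the root) -/
  par : V → V
  /-- the distance to the root -/
  depth : V → ℕ
  depth_par : ∀ v, v ≠ root → depth (par v) + 1 = depth v
  smul_par : ∀ (g : G) (v : V), v ≠ root →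
    (g • v ≠ root ∧ par (g • v) = g • par v) ∨ (g • par v ≠ root ∧ par (g • par v) = g • v)

/-- A `G`-invariant family of pairwise nested cuts, any two points being separated by finitely many
of them. -/
structure CutSystem (G : Type) [Group G] where
  /-- the cuts -/
  cuts : Set (Set G)
  compl_mem : ∀ {D}, D ∈ cuts → Dᶜ ∈ cuts
  smul_mem : ∀ (g : G) {D}, D ∈ cuts → g • D ∈ cuts
  nested : ∀ {C D}, C ∈ cuts → D ∈ cuts → Nested C D
  finite_separating : ∀ x z, {D | D ∈ cuts ∧ x ∈ D ∧ z ∉ D}.Finite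
  finite_smul_eq : ∀ {D}, D ∈ cuts → ∀ E, {g : G | g • D = E}.Finite
  exists_representatives : ∃ R : Set (Set G), R.Finite ∧ ∀ D ∈ cuts, ∃ g : G, g • D ∈ R

namespace CutSystem

variable {G : Type} [Group G] (T : CutSystem G)

/-- The vertices of the tree dual to a cut system: the consistent choices of one side of every
cut which agree with the side of `1` almost always. -/
structure IsVertex (v : Set (Set G)) : Prop where
  subset : v ⊆ T.cuts
  compl_mem_iff : ∀ {D}, D ∈ T.cuts → (Dᶜ ∈ v ↔ D ∉ v)
  mem_of_subset : ∀ {C D}, C ∈ v → D ∈ T.cuts → C ⊆ D → D ∈ v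
  finite : {D | D ∈ v ∧ 1 ∉ D}.Finite

/-- The vertices of the tree dual to a cut system. -/
abbrev Vertex : Type := {v : Set (Set G) // T.IsVertex v}

variable {T}

lemma IsVertex.smul {v : Set (Set G)} (h : T.IsVertex v) (g : G) : T.IsVertex (g • v) := by
  have hcuts : ∀ {D}, D ∈ T.cuts → g⁻¹ • D ∈ T.cuts := fun hD => T.smul_mem _ hD
  refine ⟨?_, ?_, ?_, ?_⟩
  · rintro _ ⟨D, hD, rfl⟩
    exact T.smul_mem g (h.subset hD)
  · intro D hD
    rw [Set.mem_smul_set_iff_inv_smul_mem, Set.mem_smul_set_iff_inv_smul_mem, Set.smul_set_compl,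
      h.compl_mem_iff (hcuts hD)]
  · intro C D hC hD hCD
    rw [Set.mem_smul_set_iff_inv_smul_mem] at hC ⊢
    exact h.mem_of_subset hC (hcuts hD) (Set.smul_set_mono hCD)
  · refine ((h.finite.union (T.finite_separating 1 g⁻¹)).image (g • ·)).subset ?_
    rintro _ ⟨⟨D, hD, rfl⟩, h1⟩
    refine ⟨D, ?_, rfl⟩
    by_cases h2 : 1 ∈ D
    · refine Or.inr ⟨h.subset hD, h2, fun h3 => h1 ?_⟩
      rw [Set.mem_smul_set_iff_inv_smul_mem]
      simpa using h3
    · exact Or.inl ⟨hD, h2⟩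

instance : MulAction G T.Vertex where
  smul g v := ⟨g • v.1, v.2.smul g⟩
  one_smul v := Subtype.ext (one_smul G v.1)
  mul_smul g h v := Subtype.ext (mul_smul g h v.1)

lemma coe_smul (g : G) (v : T.Vertex) : (g • v).1 = g • v.1 := rfl

variable (T) in
/-- The vertex consisting of the cuts containing `1`. -/
def root : T.Vertex where
  val := {D | D ∈ T.cuts ∧ 1 ∈ D}
  property :=
    { subset := fun _ h => h.1
      compl_mem_iff := fun {D} hD => by simp [hD, T.compl_mem hD]
      mem_of_subset := fun hC hD hCD => ⟨hD, hCD hC.2⟩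
      finite := by
        convert Set.finite_empty
        ext D
        simp only [Set.mem_ofPred_eq, Set.mem_empty_iff_false, iff_false]
        exact fun h => h.2 h.1.2 }

/-- The cut `C` is a minimal element of `v`. -/
def MinimalIn (C : Set G) (v : Set (Set G)) : Prop := C ∈ v ∧ ∀ D ∈ v, D ⊆ C → D = C

lemma MinimalIn.smul {C : Set G} {v : Set (Set G)} (h : MinimalIn C v) (g : G) :
    MinimalIn (g • C) (g • v) := by
  refine ⟨Set.smul_mem_smul_set h.1, ?_⟩
  rintro _ ⟨D, hD, rfl⟩ hDC
  have := h.2 D hD (Set.smul_set_subset_smul_set_iff.mp hDC)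
  rw [this]

lemma exists_minimalIn {v : T.Vertex} (hv : v ≠ T.root) : ∃ C, MinimalIn C v.1 ∧ 1 ∉ C := by
  have hne : {D | D ∈ v.1 ∧ 1 ∉ D}.Nonempty := by
    rw [Set.nonempty_iff_ne_empty]
    intro hc
    have h1 : ∀ D ∈ v.1, 1 ∈ D := fun D hD => by
      by_contra h
      have : D ∈ {D | D ∈ v.1 ∧ 1 ∉ D} := ⟨hD, h⟩
      rw [hc] at this
      exact this
    refine hv (Subtype.ext (Set.Subset.antisymm (fun D hD => ⟨v.2.subset hD, h1 D hD⟩) ?_))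
    rintro D ⟨hD, hD1⟩
    by_contra h
    exact h1 _ ((v.2.compl_mem_iff hD).mpr h) hD1
  obtain ⟨C, hC⟩ := v.2.finite.exists_minimal hne
  refine ⟨C, ⟨hC.prop.1, fun D hD hDC => ?_⟩, hC.prop.2⟩
  exact Set.Subset.antisymm hDC (hC.le_of_le ⟨hD, fun h => hC.prop.2 (hDC h)⟩ hDC)

lemma minimalIn_unique {v : T.Vertex} {C D : Set G} (hC : MinimalIn C v.1) (hD : MinimalIn D v.1)
    (hC1 : 1 ∉ C) (hD1 : 1 ∉ D) : C = D := by
  rcases T.nested (v.2.subset hC.1) (v.2.subset hD.1) with h | h | h | h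
  · exact hD.2 _ hC.1 h
  · exact absurd hD.1 ((v.2.compl_mem_iff (v.2.subset hD.1)).mp
      (v.2.mem_of_subset hC.1 (T.compl_mem (v.2.subset hD.1)) h))
  · exact absurd (h hC1) hD1
  · exact (hC.2 _ hD.1 (Set.compl_subset_compl.mp h)).symm

lemma subset_of_minimalIn {v w : T.Vertex} {C : Set G} (hv : MinimalIn C v.1)
    (hw : MinimalIn C w.1) : v.1 ⊆ w.1 := by
  intro D hD
  have hDT := v.2.subset hD
  by_contra hDw
  have hDw' := (w.2.compl_mem_iff hDT).mpr hDw
  have hDv : Dᶜ ∉ v.1 := fun h => (v.2.compl_mem_iff hDT).mp h hD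
  rcases T.nested (v.2.subset hv.1) hDT with h | h | h | h
  · exact hDw (w.2.mem_of_subset hw.1 hDT h)
  · exact hDv (v.2.mem_of_subset hv.1 (T.compl_mem hDT) h)
  · exact hDv (hw.2 _ hDw' (Set.compl_subset_comm.mp h) ▸ hv.1)
  · exact hDw (hv.2 _ hD (Set.compl_subset_compl.mp h) ▸ hw.1)

lemma eq_of_minimalIn {v w : T.Vertex} {C : Set G} (hv : MinimalIn C v.1)
    (hw : MinimalIn C w.1) : v = w :=
  Subtype.ext (Set.Subset.antisymm (subset_of_minimalIn hv hw) (subset_of_minimalIn hw hv))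

lemma mem_symmDiff_pair {α : Type} {v : Set (Set α)} {C D : Set α} :
    D ∈ symmDiff v {C, Cᶜ} ↔ ((D = C ∨ D = Cᶜ) ∧ D ∉ v) ∨ (¬ (D = C ∨ D = Cᶜ) ∧ D ∈ v) := by
  simp only [Set.mem_symmDiff, Set.mem_insert_iff, Set.mem_singleton_iff]
  tauto

lemma exceptional_flip {v : T.Vertex} {C : Set G} (hC : MinimalIn C v.1) (hC1 : 1 ∉ C) :
    {D | D ∈ symmDiff v.1 {C, Cᶜ} ∧ 1 ∉ D} = {D | D ∈ v.1 ∧ 1 ∉ D} \ {C} := by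
  have hC' : Cᶜ ∉ v.1 := fun h => (v.2.compl_mem_iff (v.2.subset hC.1)).mp h hC.1
  ext D
  simp only [Set.mem_ofPred_eq, mem_symmDiff_pair, Set.mem_sdiff, Set.mem_singleton_iff]
  have h1 : D = C → D ∈ v.1 := fun h => h ▸ hC.1
  have h2 : D = Cᶜ → D ∉ v.1 ∧ 1 ∈ D := by
    rintro rfl
    exact ⟨hC', hC1⟩
  tauto

lemma isVertex_flip {v : T.Vertex} {C : Set G} (hC : MinimalIn C v.1) (hC1 : 1 ∉ C) :
    T.IsVertex (symmDiff v.1 {C, Cᶜ}) := by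
  have hCT := v.2.subset hC.1
  have hC' : Cᶜ ∉ v.1 := fun h => (v.2.compl_mem_iff hCT).mp h hC.1
  have hne : C ≠ Cᶜ := fun h => hC1 (by rw [h]; exact hC1)
  refine ⟨?_, ?_, ?_, ?_⟩
  · intro D hD
    rcases mem_symmDiff_pair.mp hD with ⟨rfl | rfl, -⟩ | ⟨-, h⟩
    exacts [hCT, T.compl_mem hCT, v.2.subset h]
  · intro D hD
    have h1 := v.2.compl_mem_iff hD
    have h2 : Dᶜ = C ↔ D = Cᶜ := compl_eq_comm.trans eq_comm
    have h3 : Dᶜ = Cᶜ ↔ D = C := compl_inj_iff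
    rw [mem_symmDiff_pair, mem_symmDiff_pair, h1, h2, h3]
    tauto
  · intro D E hD hE hDE
    rw [mem_symmDiff_pair] at hD ⊢
    by_cases hE' : E = Cᶜ
    · exact Or.inl ⟨Or.inr hE', hE' ▸ hC'⟩
    have hEC : E ≠ C := by
      rintro rfl
      rcases hD with ⟨rfl | rfl, h⟩ | ⟨h, h'⟩
      · exact h hC.1
      · exact hC1 (hDE hC1)
      · exact h (Or.inl (hC.2 _ h' hDE))
    refine Or.inr ⟨not_or.mpr ⟨hEC, hE'⟩, ?_⟩
    rcases hD with ⟨rfl | rfl, h⟩ | ⟨-, h⟩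
    · exact absurd hC.1 h
    · by_contra hc
      have := hC.2 _ ((v.2.compl_mem_iff hE).mpr hc) (Set.compl_subset_comm.mp hDE)
      exact hE' (by rw [← this, compl_compl])
    · exact v.2.mem_of_subset h hE hDE
  · rw [exceptional_flip hC hC1]
    exact v.2.finite.sdiff

open Classical in
/-- The neighbour of a vertex which is closer to the root. -/
noncomputable def par (v : T.Vertex) : T.Vertex :=
  if h : v = T.root then v else
    ⟨symmDiff v.1 {(exists_minimalIn h).choose, (exists_minimalIn h).chooseᶜ},
      isVertex_flip (exists_minimalIn h).choose_spec.1 (exists_minimalIn h).choose_spec.2⟩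

lemma par_eq {v : T.Vertex} (hv : v ≠ T.root) :
    ∃ C, MinimalIn C v.1 ∧ 1 ∉ C ∧ (par v).1 = symmDiff v.1 {C, Cᶜ} := by
  refine ⟨_, (exists_minimalIn hv).choose_spec.1, (exists_minimalIn hv).choose_spec.2, ?_⟩
  rw [par, dif_neg hv]

/-- The number of cuts separating a vertex from the root. -/
noncomputable def depth (v : T.Vertex) : ℕ := {D | D ∈ v.1 ∧ 1 ∉ D}.ncard

lemma depth_par (v : T.Vertex) (hv : v ≠ T.root) : depth (par v) + 1 = depth v := by
  obtain ⟨C, hC, hC1, h⟩ := par_eq hv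
  rw [depth, h, exceptional_flip hC hC1]
  exact Set.ncard_sdiff_singleton_add_one ⟨hC.1, hC1⟩ v.2.finite

lemma par_eq_of_symmDiff {v w : T.Vertex} {C : Set G} (h : symmDiff v.1 w.1 = {C, Cᶜ})
    (hC : C ∈ v.1) (hC1 : 1 ∉ C) : v ≠ T.root ∧ par v = w := by
  have hv : v ≠ T.root := by
    rintro rfl
    exact hC1 hC.2
  refine ⟨hv, ?_⟩
  have hw : w.1 = symmDiff v.1 {C, Cᶜ} := by rw [← h, symmDiff_symmDiff_cancel_left]
  have hCT := v.2.subset hC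
  have hCv : Cᶜ ∉ v.1 := fun h => (v.2.compl_mem_iff hCT).mp h hC
  have hCw : C ∉ w.1 := by
    rw [hw, mem_symmDiff_pair]
    tauto
  have hmin : MinimalIn C v.1 := by
    refine ⟨hC, fun D hD hDC => ?_⟩
    by_contra hne
    refine hCw (w.2.mem_of_subset (C := D) ?_ hCT hDC)
    rw [hw, mem_symmDiff_pair]
    refine Or.inr ⟨not_or.mpr ⟨hne, ?_⟩, hD⟩
    rintro rfl
    exact hCv hD
  obtain ⟨C', hC', hC1', hp⟩ := par_eq hv
  refine Subtype.ext ?_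
  rw [hp, hw, minimalIn_unique hmin hC' hC1 hC1']

lemma par_eq_or_par_eq {v w : T.Vertex} {C : Set G} (h : symmDiff v.1 w.1 = {C, Cᶜ}) :
    (v ≠ T.root ∧ par v = w) ∨ (w ≠ T.root ∧ par w = v) := by
  wlog hC1 : 1 ∉ C generalizing C
  · exact this (C := Cᶜ) (by rw [h, compl_compl, Set.pair_comm]) hC1
  have hC : C ∈ symmDiff v.1 w.1 := by simp [h]
  rcases hC with ⟨hC, -⟩ | ⟨hC, -⟩
  · exact Or.inl (par_eq_of_symmDiff h hC hC1)
  · exact Or.inr (par_eq_of_symmDiff (by rwa [symmDiff_comm]) hC hC1)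

lemma smul_par (g : G) (v : T.Vertex) (hv : v ≠ T.root) :
    (g • v ≠ T.root ∧ par (g • v) = g • par v) ∨ (g • par v ≠ T.root ∧ par (g • par v) = g • v) := by
  obtain ⟨C, -, -, h⟩ := par_eq hv
  refine par_eq_or_par_eq (C := g • C) ?_
  rw [coe_smul, coe_smul, ← Set.smul_set_symmDiff, h, symmDiff_symmDiff_cancel_left,
    Set.smul_set_insert, Set.smul_set_singleton, Set.smul_set_compl]

variable (T) in
/-- The tree dual to a cut system. -/
noncomputable def tree : RootedTree G T.Vertex where
  root := T.root
  par := par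
  depth := depth
  depth_par := depth_par
  smul_par := smul_par

lemma finite_diff_of_mem {v : T.Vertex} {C : Set G} (hC : C ∈ v.1) :
    ((MulAction.stabilizer G v : Set G) \ C).Finite := by
  have h1 : (⋃ E ∈ {D | D ∈ v.1 ∧ 1 ∉ D}, {g : G | g • C = E}⁻¹).Finite :=
    v.2.finite.biUnion fun E _ => (T.finite_smul_eq (v.2.subset hC) E).inv
  refine h1.subset ?_
  rintro h ⟨hh, hC1⟩
  simp only [Set.mem_iUnion]
  refine ⟨h⁻¹ • C, ⟨?_, fun hc => hC1 ?_⟩, rfl⟩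
  · have : h⁻¹ • v = v := (MulAction.stabilizer G v).inv_mem hh
    rw [← this]
    exact Set.smul_mem_smul_set hC
  · rw [Set.mem_smul_set_iff_inv_smul_mem] at hc
    simpa using hc

lemma finite_stabilizer (hT : ∀ Y : Subgroup G, (Y : Set G).Infinite →
      ∃ D ∈ T.cuts, ((Y : Set G) ∩ D).Infinite ∧ ((Y : Set G) \ D).Infinite) (v : T.Vertex) :
    Finite (MulAction.stabilizer G v) := by
  by_contra h
  obtain ⟨D, hD, h1, h2⟩ := hT _ (Set.infinite_coe_iff.mp (not_finite_iff_infinite.mp h))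
  by_cases hv : D ∈ v.1
  · exact h2 (finite_diff_of_mem hv)
  · refine h1 ?_
    simpa [Set.sdiff_eq] using finite_diff_of_mem ((v.2.compl_mem_iff hD).mpr hv)

/-- If the cuts split every infinite subgroup, then the vertex stabilizers are bounded. -/
theorem exists_card_stabilizer_dvd (hT : ∀ Y : Subgroup G, (Y : Set G).Infinite →
      ∃ D ∈ T.cuts, ((Y : Set G) ∩ D).Infinite ∧ ((Y : Set G) \ D).Infinite) :
    ∃ N ≠ 0, ∀ v : T.Vertex, Nat.card (MulAction.stabilizer G v) ∣ N := by
  classical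
  have hfin := finite_stabilizer hT
  have hpos : ∀ v : T.Vertex, Nat.card (MulAction.stabilizer G v) ≠ 0 := fun v => Nat.card_pos.ne'
  obtain ⟨R, hR, hrep⟩ := T.exists_representatives
  let m : Set G → ℕ := fun C => if h : ∃ v : T.Vertex, MinimalIn C v.1 then
    Nat.card (MulAction.stabilizer G h.choose) else 1
  refine ⟨Nat.card (MulAction.stabilizer G T.root) * ∏ C ∈ hR.toFinset, m C,
    mul_ne_zero (hpos _) (Finset.prod_ne_zero_iff.mpr fun C _ => ?_), fun v => ?_⟩
  · by_cases h : ∃ v : T.Vertex, MinimalIn C v.1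
    · simp only [m, dif_pos h]
      exact hpos _
    · simp only [m, dif_neg h]
      exact one_ne_zero
  · by_cases hv : v = T.root
    · rw [hv]
      exact dvd_mul_right _ _
    · obtain ⟨C, hC, -⟩ := exists_minimalIn hv
      obtain ⟨g, hg⟩ := hrep C (v.2.subset hC.1)
      have h : ∃ v : T.Vertex, MinimalIn (g • C) v.1 := ⟨g • v, hC.smul g⟩
      have h1 : h.choose = g • v := eq_of_minimalIn h.choose_spec (hC.smul g)
      have h2 : Nat.card (MulAction.stabilizer G v) = m (g • C) := by
        simp only [m, dif_pos h]
        rw [h1]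
        exact Nat.card_congr (MulAction.stabilizerEquivStabilizer rfl).toEquiv
      rw [h2]
      exact (Finset.dvd_prod_of_mem m (hR.mem_toFinset.mpr hg)).trans (dvd_mul_left _ _)

end CutSystem

section ContextFree

variable {X G : Type} [Group G] {f : X → G}

/-- The cut system of optimal cuts. -/
def optimalCutSystem [Finite X] (hgen : Subgroup.closure (Set.range f) = ⊤) (k : ℕ) :
    CutSystem G where
  cuts := optimalCuts f k
  compl_mem := compl_mem_optimalCuts
  smul_mem g _ hD := (smul_mem_optimalCuts g).mpr hD
  nested := nested_of_mem_optimalCuts hgen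
  finite_separating x z := (TightCut.finite_separating (f := f) k x z).subset
    fun _ hD => ⟨optimalCuts_subset hgen hD.1, hD.2⟩
  finite_smul_eq hD E := finite_smul_eq hgen (optimalCuts_subset hgen hD) E
  exists_representatives := by
    obtain ⟨R, h1, -, h2⟩ := exists_finite_orbit_representatives hgen k
    exact ⟨R, h1, fun D hD => h2 D (optimalCuts_subset hgen hD)⟩

lemma exists_optimalCut_splitting {k : ℕ} {Y D : Set G}
    (hD : D ∈ TightCut f k) (h1 : (Y ∩ D).Infinite) (h2 : (Y \ D).Infinite) :
    ∃ E ∈ optimalCuts f k, (Y ∩ E).Infinite ∧ (Y \ E).Infinite := by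
  obtain ⟨p, hp, hp'⟩ := exists_nonprincipal h1
  obtain ⟨q, hq, hq'⟩ := exists_nonprincipal h2
  obtain ⟨E, hE⟩ := exists_optimalCut (f := f) (k := k) (Filter.mem_of_superset hp fun _ h => h.2)
    (Ultrafilter.compl_mem_iff_notMem.mp (Filter.mem_of_superset hq fun _ h => h.2)) hD.2.1 hD.2.2.1
  refine ⟨E, ⟨p, q, hE⟩, fun hf => hp' _ hf ?_, fun hf => hq' _ hf ?_⟩
  · exact Filter.inter_mem (Filter.mem_of_superset hp fun _ h => h.1) hE.1.mem
  · exact Filter.inter_mem (Filter.mem_of_superset hq fun _ h => h.1)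
      (Ultrafilter.compl_mem_iff_notMem.mpr hE.1.notMem)

/-- A group with context-free word problem acts on a tree with bounded vertex stabilizers. -/
theorem exists_tree [Finite X] (hgen : Subgroup.closure (Set.range f) = ⊤)
    (h : (wordProblem f).IsContextFree) : ∃ (V : Type) (_ : MulAction G V) (_ : RootedTree G V),
      ∃ N ≠ 0, ∀ v : V, Nat.card (MulAction.stabilizer G v) ∣ N := by
  obtain ⟨k, hk⟩ := exists_splitting hgen h
  refine ⟨(optimalCutSystem hgen k).Vertex, inferInstance, (optimalCutSystem hgen k).tree,
    CutSystem.exists_card_stabilizer_dvd fun Y hY => ?_⟩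
  obtain ⟨D, hD, h1, h2⟩ := hk Y hY
  exact exists_optimalCut_splitting hD h1 h2

end ContextFree

namespace RootedTree

variable {G V : Type} [Group G] [MulAction G V] (t : RootedTree G V)

/-- Restriction of the acting group. -/
def restrict (K : Subgroup G) : RootedTree K V where
  root := t.root
  par := t.par
  depth := t.depth
  depth_par := t.depth_par
  smul_par g v := t.smul_par g.1 v

/-- The adjacency relation of a rooted tree. -/
def Adj (v w : V) : Prop := (v ≠ t.root ∧ t.par v = w) ∨ (w ≠ t.root ∧ t.par w = v)

variable {t}

lemma Adj.symm {v w : V} (h : t.Adj v w) : t.Adj w v := Or.symm h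

lemma adj_par {v : V} (h : v ≠ t.root) : t.Adj (t.par v) v := Or.inr ⟨h, rfl⟩

lemma Adj.smul {v w : V} (h : t.Adj v w) (g : G) : t.Adj (g • v) (g • w) := by
  rcases h with ⟨h, rfl⟩ | ⟨h, rfl⟩
  · exact t.smul_par g v h
  · exact Or.symm (t.smul_par g w h)

lemma Adj.even_iff {v w : V} (h : t.Adj v w) : Even (t.depth w) ↔ ¬ Even (t.depth v) := by
  rcases h with ⟨h, rfl⟩ | ⟨h, rfl⟩
  · rw [← t.depth_par v h, Nat.even_add_one, not_not]
  · rw [← t.depth_par w h, Nat.even_add_one]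

variable (t) in
lemma induction {p : V → Prop} (root : p t.root) (step : ∀ v, v ≠ t.root → p (t.par v) → p v)
    (v : V) : p v := by
  induction hn : t.depth v using Nat.strong_induction_on generalizing v with
  | _ n ih =>
    by_cases h : v = t.root
    · rw [h]
      exact root
    · refine step v h (ih _ ?_ _ rfl)
      have := t.depth_par v h
      omega

open Classical in
variable (t) in
/-- Recursion along the tree. -/
noncomputable def build {C : V → Type} (r : C t.root) (step : ∀ v, v ≠ t.root → C (t.par v) → C v)
    (v : V) : C v :=
  if h : v = t.root then h ▸ r else step v h (build r step (t.par v))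
termination_by t.depth v
decreasing_by
  have := t.depth_par v h
  omega

lemma build_root {C : V → Type} (r : C t.root) (step : ∀ v, v ≠ t.root → C (t.par v) → C v) :
    t.build r step t.root = r := by
  rw [build, dif_pos rfl]

lemma build_of_ne {C : V → Type} (r : C t.root) (step : ∀ v, v ≠ t.root → C (t.par v) → C v) {v : V}
    (h : v ≠ t.root) : t.build r step v = step v h (t.build r step (t.par v)) := by
  rw [build, dif_neg h]

variable (t) in
/-- The action preserves the parity of the depth. -/
def PreservesParity : Prop := ∀ (g : G) (v : V), Even (t.depth (g • v)) ↔ Even (t.depth v)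

section Free

open Classical in
variable (t) in
/-- The label of a dart of the quotient graph, the even darts being positively oriented. -/
noncomputable def label (v w : V) : MulAction.orbitRel.Quotient G (V × V) × Bool :=
  if Even (t.depth v) then (Quotient.mk'' (v, w), true) else (Quotient.mk'' (w, v), false)

lemma label_smul (ht : t.PreservesParity) (g : G) (v w : V) :
    t.label (g • v) (g • w) = t.label v w := by
  have h (a b : V) : (Quotient.mk'' (g • a, g • b) : MulAction.orbitRel.Quotient G (V × V)) =
      Quotient.mk'' (a, b) := Quotient.sound' ⟨g, rfl⟩
  simp only [label, ht g v, h]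

lemma label_swap {v w : V} (h : t.Adj v w) : t.label w v = ((t.label v w).1, !(t.label v w).2) := by
  have := h.even_iff
  by_cases hv : Even (t.depth v) <;> simp [label, this, hv]

variable (t) in
/-- The labels along the path from the root to a vertex. -/
noncomputable def pathWord (v : V) : List (MulAction.orbitRel.Quotient G (V × V) × Bool) :=
  t.build (C := fun _ => List (MulAction.orbitRel.Quotient G (V × V) × Bool)) []
    (fun v _ l => l ++ [t.label (t.par v) v]) v

lemma pathWord_root : t.pathWord t.root = [] := build_root _ _

lemma pathWord_of_ne {v : V} (h : v ≠ t.root) :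
    t.pathWord v = t.pathWord (t.par v) ++ [t.label (t.par v) v] := build_of_ne _ _ h

lemma mk_pathWord_of_adj {v w : V} (h : t.Adj v w) :
    FreeGroup.mk (t.pathWord w) = FreeGroup.mk (t.pathWord v) * FreeGroup.mk [t.label v w] := by
  rcases h with ⟨h, rfl⟩ | ⟨h, rfl⟩
  · rw [pathWord_of_ne h, label_swap (adj_par h), ← FreeGroup.mul_mk, mul_assoc]
    have : FreeGroup.mk [((t.label (t.par v) v).1, !(t.label (t.par v) v).2)] =
        (FreeGroup.mk [t.label (t.par v) v])⁻¹ := by simp [FreeGroup.inv_mk, FreeGroup.invRev]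
    rw [this, mul_inv_cancel, mul_one]
  · rw [pathWord_of_ne h, FreeGroup.mul_mk]

lemma mk_pathWord_smul (ht : t.PreservesParity) (g : G) (v : V) :
    FreeGroup.mk (t.pathWord (g • v)) =
      FreeGroup.mk (t.pathWord (g • t.root)) * FreeGroup.mk (t.pathWord v) := by
  induction v using t.induction with
  | root => rw [pathWord_root, ← FreeGroup.one_eq_mk, mul_one]
  | step v h ih =>
    have := adj_par h
    rw [mk_pathWord_of_adj this, mk_pathWord_of_adj (this.smul g), ih, label_smul ht, mul_assoc]

lemma isReduced_pathWord (hfree : ∀ (g : G) (v : V), g • v = v → g = 1) (v : V) :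
    FreeGroup.IsReduced (t.pathWord v) := by
  induction v using t.induction with
  | root =>
    rw [pathWord_root]
    exact List.isChain_nil
  | step v h ih =>
    rw [pathWord_of_ne h]
    refine List.isChain_append.mpr ⟨ih, List.isChain_singleton _, ?_⟩
    by_cases h' : t.par v = t.root
    · simp [h', pathWord_root]
    have hadj := adj_par h
    have hadj' := adj_par h'
    have hne : t.par (t.par v) ≠ v := by
      intro hc
      have h1 := t.depth_par v h
      have h2 := t.depth_par _ h'
      rw [hc] at h2
      omega
    rw [pathWord_of_ne h']
    simp only [List.getLast?_append, List.getLast?_singleton, List.head?_cons, Option.mem_def,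
      Option.some_or, Option.some.injEq]
    rintro _ rfl _ rfl heq
    exfalso
    apply hne
    have h1 := hadj.even_iff
    have h2 := hadj'.even_iff
    by_cases hp : Even (t.depth (t.par v))
    · have h3 : ¬ Even (t.depth (t.par (t.par v))) := by tauto
      simp only [label, if_pos hp, if_neg h3] at heq
      obtain ⟨g, hg⟩ := Quotient.exact' heq
      simp only [Prod.smul_mk, Prod.mk.injEq] at hg
      rw [hfree _ _ hg.1, one_smul] at hg
      exact hg.2.symm.trans (one_smul G v)
    · have h3 : Even (t.depth (t.par (t.par v))) := by tauto
      simp only [label, if_neg hp, if_pos h3] at heq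
      obtain ⟨g, hg⟩ := Quotient.exact' heq
      simp only [Prod.smul_mk, Prod.mk.injEq] at hg
      rw [hfree _ _ hg.2, one_smul] at hg
      exact hg.1.symm

/-- A group acting freely and without inversions on a tree is free. -/
theorem isFreeGroup (t : RootedTree G V) (ht : t.PreservesParity)
    (hfree : ∀ (g : G) (v : V), g • v = v → g = 1) : IsFreeGroup G := by
  classical
  let φ : G →* FreeGroup (MulAction.orbitRel.Quotient G (V × V)) :=
    MonoidHom.mk' (fun g => FreeGroup.mk (t.pathWord (g • t.root))) fun g h => by
      rw [mul_smul, mk_pathWord_smul ht]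
  have hφ : Function.Injective φ := by
    rw [injective_iff_map_eq_one]
    intro g hg
    apply hfree g t.root
    by_contra hne
    have h1 : FreeGroup.mk (t.pathWord (g • t.root)) = 1 := hg
    have h2 := (isReduced_pathWord (t := t) hfree (g • t.root)).reduce_eq
    rw [← FreeGroup.toWord_mk, h1, FreeGroup.toWord_one, pathWord_of_ne hne] at h2
    simp at h2
  exact IsFreeGroup.ofMulEquiv (MonoidHom.ofInjective hφ).symm

end Free

end RootedTree

section Bundle

variable {G V : Type} [Group G] [MulAction G V]

/-- If the orders of the stabilizers divide `N`, there is a free `G`-set over `V` all of whose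
fibers have `N` elements. -/
lemma exists_free_bundle {N : ℕ}
    (h : ∀ v : V, Nat.card (MulAction.stabilizer G v) ∣ N) :
    ∃ (E : Type) (_ : MulAction G E) (π : E → V), (∀ (g : G) e, π (g • e) = g • π e) ∧
      (∀ (g : G) (e : E), g • e = e → g = 1) ∧ ∀ v, (π ⁻¹' {v}).ncard = N := by
  let m : MulAction.orbitRel.Quotient G V → ℕ :=
    fun o => N / Nat.card (MulAction.stabilizer G o.out)
  refine ⟨G × Σ o, Fin (m o),
    { smul := fun g e => (g * e.1, e.2)
      one_smul := fun e => Prod.ext (one_mul e.1) rfl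
      mul_smul := fun g h e => Prod.ext (mul_assoc g h e.1) rfl },
    fun e => e.1 • e.2.1.out, fun g e => mul_smul g e.1 _, fun g e he => ?_, fun v => ?_⟩
  · exact mul_eq_right.mp (congrArg Prod.fst he)
  · let o : MulAction.orbitRel.Quotient G V := Quotient.mk'' v
    obtain ⟨s, hs⟩ : ∃ s : G, s • o.out = v := by
      have : (Quotient.mk'' v : MulAction.orbitRel.Quotient G V) = Quotient.mk'' o.out :=
        (Quotient.out_eq' o).symm
      obtain ⟨g, hg⟩ := Quotient.exact' this
      exact ⟨g, hg⟩
    let F : MulAction.stabilizer G o.out × Fin (m o) → G × Σ o, Fin (m o) :=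
      fun x => (s * x.1, ⟨o, x.2⟩)
    have hF : Function.Injective F := by
      rintro ⟨a, i⟩ ⟨b, j⟩ hab
      simpa [F] using hab
    have hrange : (fun e : G × Σ o, Fin (m o) => e.1 • e.2.1.out) ⁻¹' {v} = Set.range F := by
      ext ⟨g, o', i⟩
      simp only [Set.mem_preimage, Set.mem_singleton_iff, Set.mem_range, Prod.exists]
      constructor
      · intro hg
        obtain rfl : o' = o := by
          rw [← Quotient.out_eq' o']
          exact Quotient.sound' ⟨g⁻¹, by rw [← hg]; exact inv_smul_smul g _⟩
        refine ⟨⟨s⁻¹ * g, ?_⟩, i, ?_⟩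
        · rw [MulAction.mem_stabilizer_iff, mul_smul, hg, inv_smul_eq_iff, hs]
        · simp [F]
      · rintro ⟨a, j, hj⟩
        simp only [F, Prod.mk.injEq] at hj
        obtain ⟨rfl, hj⟩ := hj
        obtain rfl : o = o' := congrArg Sigma.fst hj
        rw [mul_smul, a.2, hs]
    rw [hrange, ← Nat.card_coe_set_eq, Nat.card_range_of_injective hF, Nat.card_prod,
      Nat.card_fin]
    exact Nat.mul_div_cancel' (h _)

end Bundle

lemma exists_rel_of_ncard_eq {α : Type} {A B : Set α} {R : α → α → Prop} (hB : B.Finite)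
    (h : A.ncard = B.ncard) (huniq : ∀ a ∈ A, ∀ a' ∈ A, ∀ b, R a b → R a' b → a = a')
    (hex : ∀ a ∈ A, ∃ b ∈ B, R a b) : ∀ b ∈ B, ∃ a ∈ A, R a b := by
  choose! φ hφB hφ using hex
  have hinj : Set.InjOn φ A := fun a ha a' ha' haa' =>
    huniq a ha a' ha' (φ a) (hφ a ha) (haa' ▸ hφ a' ha')
  have himg : φ '' A = B := by
    refine Set.eq_of_subset_of_ncard_le ?_ ?_ hB
    · rintro _ ⟨a, ha, rfl⟩
      exact hφB a ha
    · rw [hinj.ncard_image, h]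
  intro b hb
  rw [← himg] at hb
  obtain ⟨a, ha, rfl⟩ := hb
  exact ⟨a, ha, hφ a ha⟩

namespace RootedTree

variable {G V E : Type} [Group G] [MulAction G V] [MulAction G E] {t : RootedTree G V} {π : E → V}

variable (t π) in
/-- An invariant system of partial matchings between the fibers over adjacent vertices. -/
structure PartialConnection (Q : Set (E × E)) : Prop where
  adj : ∀ x ∈ Q, t.Adj (π x.1) (π x.2)
  even : ∀ x ∈ Q, Even (t.depth (π x.1))
  smul : ∀ (g : G), ∀ x ∈ Q, g • x ∈ Q
  left_unique : ∀ x ∈ Q, ∀ y ∈ Q, π x.2 = π y.2 → x.1 = y.1 → x.2 = y.2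
  right_unique : ∀ x ∈ Q, ∀ y ∈ Q, π x.1 = π y.1 → x.2 = y.2 → x.1 = y.1

lemma exists_maximal_partialConnection : ∃ Q, Maximal (PartialConnection t π) Q := by
  refine zorn_subset {Q | PartialConnection t π Q} fun c hc hchain => ?_
  refine ⟨⋃₀ c, ⟨?_, ?_, ?_, ?_, ?_⟩, fun S hS => Set.subset_sUnion_of_mem hS⟩
  · rintro x ⟨S, hS, hx⟩
    exact (hc hS).adj x hx
  · rintro x ⟨S, hS, hx⟩
    exact (hc hS).even x hx
  · rintro g x ⟨S, hS, hx⟩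
    exact ⟨S, hS, (hc hS).smul g x hx⟩
  · rintro x ⟨S, hS, hx⟩ y ⟨S', hS', hy⟩
    rcases hchain.total hS hS' with h | h
    · exact (hc hS').left_unique x (h hx) y hy
    · exact (hc hS).left_unique x hx y (h hy)
  · rintro x ⟨S, hS, hx⟩ y ⟨S', hS', hy⟩
    rcases hchain.total hS hS' with h | h
    · exact (hc hS').right_unique x (h hx) y hy
    · exact (hc hS).right_unique x hx y (h hy)

lemma PartialConnection.insert_orbit {Q : Set (E × E)} (hQ : PartialConnection t π Q)
    (ht : t.PreservesParity) (hπ : ∀ (g : G) e, π (g • e) = g • π e)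
    (hfree : ∀ (g : G) (e : E), g • e = e → g = 1) {a b : E} (hadj : t.Adj (π a) (π b))
    (heven : Even (t.depth (π a))) (ha : ∀ b', π b' = π b → (a, b') ∉ Q)
    (hb : ∀ a', π a' = π a → (a', b) ∉ Q) :
    PartialConnection t π (Q ∪ MulAction.orbit G (a, b)) := by
  have hinj (e : E) {g h : G} (hgh : g • e = h • e) : g = h := by
    have : h⁻¹ * g = 1 := hfree _ e (by rw [mul_smul, hgh, inv_smul_smul])
    rwa [inv_mul_eq_one, eq_comm] at this
  have hleft : ∀ x ∈ Q, ∀ g : G, π x.2 = π (g • b) → x.1 ≠ g • a := by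
    intro x hx g h1 h2
    refine ha (g⁻¹ • x.2) (by rw [hπ, h1, hπ, inv_smul_smul]) ?_
    have := hQ.smul g⁻¹ x hx
    rwa [Prod.smul_def, h2, inv_smul_smul] at this
  have hright : ∀ x ∈ Q, ∀ g : G, π x.1 = π (g • a) → x.2 ≠ g • b := by
    intro x hx g h1 h2
    refine hb (g⁻¹ • x.1) (by rw [hπ, h1, hπ, inv_smul_smul]) ?_
    have := hQ.smul g⁻¹ x hx
    rwa [Prod.smul_def, h2, inv_smul_smul] at this
  refine ⟨?_, ?_, ?_, ?_, ?_⟩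
  · rintro x (hx | ⟨g, rfl⟩)
    · exact hQ.adj x hx
    · simpa [hπ] using hadj.smul g
  · rintro x (hx | ⟨g, rfl⟩)
    · exact hQ.even x hx
    · simpa [hπ, ht g] using heven
  · rintro g x (hx | ⟨h, rfl⟩)
    · exact Or.inl (hQ.smul g x hx)
    · exact Or.inr ⟨g * h, mul_smul g h _⟩
  · rintro x (hx | ⟨g, rfl⟩) y (hy | ⟨h, rfl⟩) h1 h2
    · exact hQ.left_unique x hx y hy h1 h2
    · exact absurd h2 (hleft x hx h h1)
    · exact absurd h2.symm (hleft y hy g h1.symm)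
    · rw [hinj a h2]
  · rintro x (hx | ⟨g, rfl⟩) y (hy | ⟨h, rfl⟩) h1 h2
    · exact hQ.right_unique x hx y hy h1 h2
    · exact absurd h2 (hright x hx h h1)
    · exact absurd h2.symm (hright y hy g h1.symm)
    · rw [hinj b h2]

/-- A free `G`-set over a tree with finite fibers of constant size carries an invariant connection
along the edges. -/
lemma exists_connection (ht : t.PreservesParity) (hπ : ∀ (g : G) e, π (g • e) = g • π e)
    (hfree : ∀ (g : G) (e : E), g • e = e → g = 1) {N : ℕ} (hN : N ≠ 0)
    (hcard : ∀ v, (π ⁻¹' {v}).ncard = N) :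
    ∃ Q : E → E → Prop, (∀ a b, Q a b → Q b a) ∧ (∀ (g : G) a b, Q a b → Q (g • a) (g • b)) ∧
      ∀ e w, t.Adj (π e) w → ∃! e', π e' = w ∧ Q e e' := by
  obtain ⟨Q, hQ, hmax⟩ := exists_maximal_partialConnection (t := t) (π := π)
  have hfin (v : V) : (π ⁻¹' {v}).Finite := Set.finite_of_ncard_ne_zero (by rwa [hcard])
  have htotal {v w : V} (hadj : t.Adj v w) (hv : Even (t.depth v)) :
      (∀ a ∈ π ⁻¹' {v}, ∃ b ∈ π ⁻¹' {w}, (a, b) ∈ Q) ∧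
        ∀ b ∈ π ⁻¹' {w}, ∃ a ∈ π ⁻¹' {v}, (a, b) ∈ Q := by
    have hl : (∀ a ∈ π ⁻¹' {v}, ∃ b ∈ π ⁻¹' {w}, (a, b) ∈ Q) →
        ∀ b ∈ π ⁻¹' {w}, ∃ a ∈ π ⁻¹' {v}, (a, b) ∈ Q :=
      exists_rel_of_ncard_eq (R := fun a b => (a, b) ∈ Q) (hfin w) (by rw [hcard, hcard])
        fun a ha a' ha' b h h' => hQ.right_unique _ h _ h' (ha.trans ha'.symm) rfl
    have hr : (∀ b ∈ π ⁻¹' {w}, ∃ a ∈ π ⁻¹' {v}, (a, b) ∈ Q) →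
        ∀ a ∈ π ⁻¹' {v}, ∃ b ∈ π ⁻¹' {w}, (a, b) ∈ Q :=
      exists_rel_of_ncard_eq (R := fun b a => (a, b) ∈ Q) (hfin v) (by rw [hcard, hcard])
        fun b hb b' hb' a h h' => hQ.left_unique _ h _ h' (hb.trans hb'.symm) rfl
    by_contra hc
    have h1 : ¬ ∀ a ∈ π ⁻¹' {v}, ∃ b ∈ π ⁻¹' {w}, (a, b) ∈ Q := fun h => hc ⟨h, hl h⟩
    have h2 : ¬ ∀ b ∈ π ⁻¹' {w}, ∃ a ∈ π ⁻¹' {v}, (a, b) ∈ Q := fun h => hc ⟨hr h, h⟩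
    push Not at h1 h2
    obtain ⟨a, rfl, ha⟩ := h1
    obtain ⟨b, rfl, hb⟩ := h2
    exact ha b rfl (hmax (hQ.insert_orbit ht hπ hfree hadj hv ha hb) Set.subset_union_left
      (Or.inr (MulAction.mem_orbit_self _)))
  refine ⟨fun a b => (a, b) ∈ Q ∨ (b, a) ∈ Q, fun a b => Or.symm,
    fun g a b => Or.imp (hQ.smul g _) (hQ.smul g _), fun e w hadj => ?_⟩
  have hpar := hadj.even_iff
  by_cases hv : Even (t.depth (π e))
  · obtain ⟨b, rfl, hb⟩ := (htotal hadj hv).1 e rfl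
    refine ⟨b, ⟨rfl, Or.inl hb⟩, ?_⟩
    rintro b' ⟨h, h' | h'⟩
    · exact hQ.left_unique _ h' _ hb h rfl
    · exact absurd hv (hpar.mp (h ▸ hQ.even _ h'))
  · obtain ⟨a, rfl, ha⟩ := (htotal hadj.symm (hpar.mpr hv)).2 e rfl
    refine ⟨a, ⟨rfl, Or.inr ha⟩, ?_⟩
    rintro a' ⟨h, h' | h'⟩
    · exact absurd (hQ.even _ h') hv
    · exact hQ.right_unique _ h' _ ha h rfl

end RootedTree

lemma VirtuallyFree.of_subgroup {G : Type} [Group G] (H : Subgroup G) [H.FiniteIndex]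
    (h : VirtuallyFree H) : VirtuallyFree G := by
  obtain ⟨K, hK, hfree⟩ := h
  refine ⟨K.map H.subtype, ⟨?_⟩, ?_⟩
  · rw [Subgroup.index_map_subtype]
    exact mul_ne_zero hK.index_ne_zero Subgroup.FiniteIndex.index_ne_zero
  · exact IsFreeGroup.ofMulEquiv (K.equivMapOfInjective H.subtype H.subtype_injective)

namespace RootedTree

variable {G V : Type} [Group G] [MulAction G V]

section Sections

variable {E : Type}

/-- Sections of `π` which are parallel along the edges. -/
abbrev FlatSection (t : RootedTree G V) (π : E → V) (Q : E → E → Prop) : Type :=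
  {s : V → E // (∀ v, π (s v) = v) ∧ ∀ v w, t.Adj v w → Q (s v) (s w)}

variable {t : RootedTree G V} {π : E → V} {Q : E → E → Prop}

lemma exists_flatSection (hsymm : ∀ a b, Q a b → Q b a)
    (hQ : ∀ e w, t.Adj (π e) w → ∃! e', π e' = w ∧ Q e e') {e : E} (he : π e = t.root) :
    Nonempty (FlatSection t π Q) := by
  have hstep (v : V) (hv : v ≠ t.root) (x : {e : E // π e = t.par v}) :
      ∃ y : {e : E // π e = v}, Q x.1 y.1 := by
    obtain ⟨y, hy, -⟩ := hQ x.1 v (by rw [x.2]; exact adj_par hv)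
    exact ⟨⟨y, hy.1⟩, hy.2⟩
  choose F hF using hstep
  let s := t.build (C := fun v => {e : E // π e = v}) ⟨e, he⟩ F
  have hs (v : V) (hv : v ≠ t.root) : Q (s (t.par v)).1 (s v).1 := by
    have : s v = F v hv (s (t.par v)) := build_of_ne _ _ hv
    rw [this]
    exact hF v hv _
  refine ⟨⟨fun v => (s v).1, fun v => (s v).2, ?_⟩⟩
  rintro v w (⟨hv, rfl⟩ | ⟨hw, rfl⟩)
  exacts [hsymm _ _ (hs v hv), hs w hw]

lemma FlatSection.eq_of_apply_root (hQ : ∀ e w, t.Adj (π e) w → ∃! e', π e' = w ∧ Q e e')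
    {r s : FlatSection t π Q} (h : r.1 t.root = s.1 t.root) : r = s := by
  refine Subtype.ext (funext fun v => ?_)
  induction v using t.induction with
  | root => exact h
  | step v hv ih =>
    have hadj := adj_par hv
    have hr := r.2.2 _ _ hadj
    rw [ih] at hr
    exact (hQ _ v (by rw [s.2.1]; exact hadj)).unique ⟨r.2.1 v, hr⟩ ⟨s.2.1 v, s.2.2 _ _ hadj⟩

lemma finite_flatSection (hQ : ∀ e w, t.Adj (π e) w → ∃! e', π e' = w ∧ Q e e')
    (hfin : (π ⁻¹' {t.root}).Finite) : Finite (FlatSection t π Q) := by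
  have := hfin.to_subtype
  refine Finite.of_injective (fun s : FlatSection t π Q =>
    (⟨s.1 t.root, s.2.1 _⟩ : π ⁻¹' {t.root})) fun r s h => ?_
  exact FlatSection.eq_of_apply_root hQ (congrArg Subtype.val h)

variable (t) in
/-- The action on flat sections. -/
@[reducible] def flatSectionAction [MulAction G E] (hπ : ∀ (g : G) e, π (g • e) = g • π e)
    (hinv : ∀ (g : G) a b, Q a b → Q (g • a) (g • b)) : MulAction G (FlatSection t π Q) where
  smul g s := ⟨fun v => g • s.1 (g⁻¹ • v), fun v => by rw [hπ, s.2.1, smul_inv_smul],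
    fun v w h => hinv g _ _ (s.2.2 _ _ (h.smul g⁻¹))⟩
  one_smul s := Subtype.ext <| funext fun v => by
    change (1 : G) • s.1 ((1 : G)⁻¹ • v) = s.1 v
    simp
  mul_smul g h s := Subtype.ext <| funext fun v => by
    change (g * h) • s.1 ((g * h)⁻¹ • v) = g • h • s.1 (h⁻¹ • g⁻¹ • v)
    simp [mul_smul]

end Sections

/-- A group acting without inversions on a tree with bounded stabilizers has a subgroup of finite
index which acts freely. -/
lemma exists_finiteIndex_free (t : RootedTree G V) (ht : t.PreservesParity) {N : ℕ} (hN : N ≠ 0)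
    (hcard : ∀ v : V, Nat.card (MulAction.stabilizer G v) ∣ N) :
    ∃ K : Subgroup G, K.FiniteIndex ∧ ∀ k ∈ K, ∀ v : V, k • v = v → k = 1 := by
  obtain ⟨E, _, π, hπ, hfree, hfib⟩ := exists_free_bundle hcard
  obtain ⟨Q, hsymm, hinv, hQ⟩ := exists_connection ht hπ hfree hN hfib
  have hfin (v : V) : (π ⁻¹' {v}).Finite := Set.finite_of_ncard_ne_zero (by rwa [hfib])
  obtain ⟨e, he⟩ : (π ⁻¹' {t.root}).Nonempty := Set.nonempty_of_ncard_ne_zero (by rwa [hfib])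
  obtain ⟨s⟩ := exists_flatSection hsymm hQ he
  have := finite_flatSection hQ (hfin t.root)
  let _ := flatSectionAction t hπ hinv
  refine ⟨(MulAction.toPermHom G (FlatSection t π Q)).ker, inferInstance, fun k hk v hv => ?_⟩
  have h1 : k • s = s := by
    have := Equiv.congr_fun (MonoidHom.mem_ker.mp hk) s
    simpa using this
  have h2 : k • s.1 (k⁻¹ • v) = s.1 v := congrFun (congrArg Subtype.val h1) v
  rw [inv_smul_eq_iff.mpr hv.symm] at h2
  exact hfree k _ h2

section Parity

variable (t : RootedTree G V)

lemma depth_smul_sub (g : G) (v : V) : (t.depth (g • v) : ZMod 2) - t.depth v =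
    t.depth (g • t.root) - t.depth t.root := by
  have key {v w : V} (h : t.Adj v w) : (t.depth w : ZMod 2) = t.depth v + 1 := by
    have : (2 : ZMod 2) = 0 := rfl
    rcases h with ⟨h, rfl⟩ | ⟨h, rfl⟩
    · rw [← t.depth_par v h]
      push_cast
      linear_combination -this
    · rw [← t.depth_par w h]
      push_cast
      rfl
  induction v using t.induction with
  | root => rfl
  | step v h ih =>
    rw [← ih, key (adj_par h), key ((adj_par h).smul g)]
    ring

/-- The homomorphism recording whether an element preserves the parity of the depth. -/
noncomputable def parityHom : G →* Multiplicative (ZMod 2) :=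
  MonoidHom.mk' (fun g => Multiplicative.ofAdd ((t.depth (g • t.root) : ZMod 2) - t.depth t.root))
    fun g h => by
      rw [← ofAdd_add, ← t.depth_smul_sub g (h • t.root), mul_smul]
      congr 1
      ring

lemma preservesParity_restrict_ker : (t.restrict t.parityHom.ker).PreservesParity := by
  rintro ⟨g, hg⟩ v
  have h1 : (t.depth (g • t.root) : ZMod 2) - t.depth t.root = 0 := hg
  rw [← t.depth_smul_sub g v, sub_eq_zero] at h1
  change Even (t.depth (g • v)) ↔ Even (t.depth v)
  rw [← ZMod.natCast_eq_zero_iff_even, ← ZMod.natCast_eq_zero_iff_even, h1]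

end Parity

/-- A group acting on a tree with bounded finite stabilizers is virtually free. -/
theorem virtuallyFree (t : RootedTree G V) {N : ℕ} (hN : N ≠ 0)
    (hcard : ∀ v : V, Nat.card (MulAction.stabilizer G v) ∣ N) : VirtuallyFree G := by
  let H := t.parityHom.ker
  have hH : H.FiniteIndex := inferInstance
  refine VirtuallyFree.of_subgroup H ?_
  have ht := t.preservesParity_restrict_ker
  obtain ⟨K, hK, hfree⟩ := (t.restrict H).exists_finiteIndex_free ht hN fun v => by
    refine (Subgroup.card_dvd_of_injective
      (H.subtype.subgroupMap (MulAction.stabilizer H v)) ?_).trans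
        ((Subgroup.card_dvd_of_le ?_).trans (hcard v))
    · rintro ⟨a, ha⟩ ⟨b, hb⟩ hab
      simpa using congrArg Subtype.val hab
    · rintro _ ⟨a, ha, rfl⟩
      exact ha
  refine ⟨K, hK, ((t.restrict H).restrict K).isFreeGroup (fun g v => ht g.1 v) fun g v hg => ?_⟩
  exact Subtype.ext (hfree g.1 g.2 v hg)

end RootedTree

section FreeGroupWords

open FreeGroup

lemma finite_of_fg_freeGroup (Y : Type) [Group.FG (FreeGroup Y)] : Finite Y := by
  classical
  let φ : FreeGroup Y →* Multiplicative (Y →₀ ℤ) :=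
    FreeGroup.lift fun y => Multiplicative.ofAdd (Finsupp.single y 1)
  have hφ : Function.Surjective φ := by
    intro m
    change m ∈ φ.range
    induction m using Multiplicative.rec with
    | _ m =>
    induction m using Finsupp.induction_linear with
    | zero => exact one_mem _
    | add u v hu hv => exact mul_mem hu hv
    | single y n =>
      refine ⟨FreeGroup.of y ^ n, ?_⟩
      rw [map_zpow, FreeGroup.lift_apply_of, ← ofAdd_zsmul, Finsupp.smul_single, smul_eq_mul,
        mul_one]
  have h1 : Group.FG (Multiplicative (Y →₀ ℤ)) := Group.fg_of_surjective hφ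
  have h2 : AddGroup.FG (Y →₀ ℤ) := AddGroup.fg_iff_mul_fg.mpr h1
  have h3 : Module.Finite ℤ (Y →₀ ℤ) := Module.Finite.iff_addGroup_fg.mpr h2
  exact Module.Finite.finite_basis (Finsupp.basisSingleOne (R := ℤ) (ι := Y))

variable {Y : Type} [DecidableEq Y]

lemma finite_norm_le [Finite Y] (n : ℕ) : {x : FreeGroup Y | x.norm ≤ n}.Finite :=
  (List.finite_length_le (Y × Bool) n).preimage toWord_injective.injOn

lemma toWord_mul_singleton (x : FreeGroup Y) (s : Y × Bool) :
    (x * mk [s]).toWord = x.toWord ++ [s] ∨ ∃ t, x.toWord = (x * mk [s]).toWord ++ [t] := by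
  by_cases h : IsReduced (x.toWord ++ [s])
  · left
    rw [toWord_mul, toWord_mk, reduce_singleton, h.reduce_eq]
  · right
    obtain hx | ⟨l, t, hx⟩ := List.eq_nil_or_concat x.toWord
    · simp [hx] at h
    · have hr : IsReduced x.toWord := isReduced_toWord
      rw [hx, List.concat_eq_append] at h hr
      have hl : IsReduced l := (List.isChain_append.mp hr).1
      have hts : t.1 = s.1 ∧ t.2 ≠ s.2 := by
        by_contra hc
        apply h
        refine List.isChain_append.mpr ⟨hr, List.isChain_singleton _, ?_⟩
        intro a ha b hb
        simp at ha hb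
        subst ha hb
        tauto
      have hs : mk [t] * mk [s] = (1 : FreeGroup Y) := by
        obtain ⟨a, b⟩ := t
        obtain ⟨c, d⟩ := s
        obtain ⟨rfl, hbd⟩ := hts
        obtain rfl : d = !b := by cases b <;> cases d <;> simp_all
        rw [mul_mk]
        exact Quot.sound (Red.Step.not (L₁ := []) (L₂ := []))
      refine ⟨t, ?_⟩
      have h2 : x * mk [s] = mk l := by
        rw [← mk_toWord (x := x), hx, List.concat_eq_append, ← mul_mk, mul_assoc, hs, mul_one]
      rw [h2, toWord_mk, hl.reduce_eq, hx, List.concat_eq_append]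

lemma length_toWord_le_of_enters_cone {u : List (Y × Bool)} (l : List (Y × Bool)) {a : FreeGroup Y}
    (ha : ¬ u <+: a.toWord) (hb : u <+: (a * mk l).toWord) :
    (a * mk l).norm ≤ u.length + l.length := by
  induction l using List.reverseRecOn with
  | nil => simp [← one_eq_mk] at hb; contradiction
  | append_singleton l s ih =>
    rw [← mul_mk, ← mul_assoc] at hb ⊢
    rw [List.length_append, List.length_singleton]
    by_cases hc : u <+: (a * mk l).toWord
    · have h1 := ih hc
      have h2 := norm_mul_le (a * mk l) (mk [s])
      have h3 : (mk [s] : FreeGroup Y).norm ≤ 1 := norm_mk_le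
      lia
    · obtain h | ⟨t, h⟩ := toWord_mul_singleton (a * mk l) s
      · rw [h, List.prefix_concat_iff] at hb
        obtain rfl | hb := hb
        · rw [FreeGroup.norm, h]; lia
        · contradiction
      · exact absurd (hb.trans (by rw [h]; exact List.prefix_append _ _)) hc

/-- A path between group elements that enters the cone of `u` passes close to `u`. -/
lemma norm_inv_mul_le_of_enters_cone {u : List (Y × Bool)} {a b : FreeGroup Y}
    (ha : ¬ u <+: a.toWord) (hb : u <+: b.toWord) :
    ((mk u)⁻¹ * b).norm ≤ (a⁻¹ * b).norm := by
  have h := length_toWord_le_of_enters_cone (a⁻¹ * b).toWord ha (by rwa [mk_toWord, mul_inv_cancel_left])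
  rw [mk_toWord, mul_inv_cancel_left] at h
  obtain ⟨y, hy⟩ := hb
  have h1 : (mk u)⁻¹ * b = mk y := by
    rw [← mk_toWord (x := b), ← hy, ← mul_mk, inv_mul_cancel_left]
  have h2 : b.norm = u.length + y.length := by rw [FreeGroup.norm, ← hy, List.length_append]
  have h3 : (mk y : FreeGroup Y).norm ≤ y.length := norm_mk_le
  have h4 : (a⁻¹ * b).toWord.length = (a⁻¹ * b).norm := rfl
  rw [h1]
  lia

/-- A sequence in a free group with steps bounded by `D` and endpoints at distance at most
`3 * D + 1` has an intermediate term at distance at most `3 * D + 1` from both ends. -/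
lemma exists_intermediate {D n : ℕ} (hn : 2 ≤ n) (x : ℕ → FreeGroup Y) (h0 : x 0 = 1)
    (hstep : ∀ i < n, ((x i)⁻¹ * x (i + 1)).norm ≤ D) (hlast : (x n).norm ≤ 3 * D + 1) :
    ∃ i, 0 < i ∧ i < n ∧ (x i).norm ≤ 3 * D + 1 ∧ ((x i)⁻¹ * x n).norm ≤ 3 * D + 1 := by
  have hx1 : (x 1).norm ≤ D := by simpa [h0] using hstep 0 (by lia)
  by_cases h1 : ((x 1)⁻¹ * x n).norm ≤ 3 * D + 1
  · exact ⟨1, by lia, by lia, by lia, h1⟩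
  have hbig : 2 * D + 1 < (x n).norm := by
    have := norm_mul_le (x 1)⁻¹ (x n)
    rw [norm_inv_eq] at this
    lia
  obtain ⟨u, hu⟩ : ∃ u, u = (x n).toWord.take (D + 1) := ⟨_, rfl⟩
  have hul : u.length = D + 1 := by
    rw [hu, List.length_take]
    exact min_eq_left (by rw [FreeGroup.norm] at hbig; lia)
  have hun : u <+: (x n).toWord := by rw [hu]; exact List.take_prefix _ _
  have hu0 : ¬ u <+: (x 0).toWord := by
    rw [h0, toWord_one, List.prefix_nil]
    rintro rfl
    simp at hul
  obtain ⟨i, hin, hi, hi'⟩ : ∃ i < n, ¬ u <+: (x i).toWord ∧ u <+: (x (i + 1)).toWord := by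
    by_contra! hc
    have : ∀ i ≤ n, ¬ u <+: (x i).toWord := by
      intro i
      induction i with
      | zero => exact fun _ => hu0
      | succ i ih => exact fun h => hc i (by lia) (ih (by lia))
    exact this n le_rfl hun
  have hclose := (norm_inv_mul_le_of_enters_cone hi hi').trans (hstep i hin)
  have humk : (mk u : FreeGroup Y).norm ≤ D + 1 := norm_mk_le.trans hul.le
  have hle : (x (i + 1)).norm ≤ 2 * D + 1 := by
    have := norm_mul_le (mk u) ((mk u)⁻¹ * x (i + 1))
    rw [mul_inv_cancel_left] at this
    lia
  refine ⟨i + 1, by lia, lt_of_le_of_ne hin ?_, by lia, ?_⟩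
  · rintro rfl
    lia
  · have h2 : ((mk u)⁻¹ * x n).norm + (D + 1) ≤ (x n).norm := by
      obtain ⟨y, hy⟩ := hun
      have h3 : (mk u)⁻¹ * x n = mk y := by
        rw [← mk_toWord (x := x n), ← hy, ← mul_mk, inv_mul_cancel_left]
      have h4 : (mk y : FreeGroup Y).norm ≤ y.length := norm_mk_le
      rw [h3, FreeGroup.norm, FreeGroup.norm, ← hy, List.length_append, hul, add_comm]
      rw [FreeGroup.norm] at h4
      lia
    have h5 := norm_mul_le (((mk u)⁻¹ * x (i + 1))⁻¹) ((mk u)⁻¹ * x n)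
    rw [norm_inv_eq, mul_inv_rev, inv_inv, mul_assoc, mul_inv_cancel_left] at h5
    lia

end FreeGroupWords

section Grammar

open FreeGroup

variable {G : Type} [Group G]

/-- A finitely generated virtually free group maps to a free group of finite rank so that the
distance between the images of `g` and `g * b` controls `b` and is controlled by `b`. -/
lemma exists_map_freeGroup [Group.FG G] (h : VirtuallyFree G) :
    ∃ (Y : Type) (_ : DecidableEq Y) (ψ : G → FreeGroup Y),
      (∀ k, {b | ∃ g, ((ψ g)⁻¹ * ψ (g * b)).norm ≤ k}.Finite) ∧
      ∀ b, ∃ k, ∀ g, ((ψ g)⁻¹ * ψ (g * b)).norm ≤ k := by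
  classical
  obtain ⟨H, hfin, hfree⟩ := h
  let e : H ≃* FreeGroup (IsFreeGroup.Generators H) := IsFreeGroup.toFreeGroup H
  have hfg : Group.FG (FreeGroup (IsFreeGroup.Generators H)) :=
    Group.fg_of_surjective (f := e.toMonoidHom) e.surjective
  have hY : Finite (IsFreeGroup.Generators H) := finite_of_fg_freeGroup _
  let q : G → G ⧸ H := fun g => (g⁻¹ : G)
  have hq (g : G) : g * (q g).out ∈ H := by
    have := QuotientGroup.eq.mp (q g).out_eq'.symm
    rwa [inv_inv] at this
  let ψ : G → FreeGroup (IsFreeGroup.Generators H) := fun g => e ⟨g * (q g).out, hq g⟩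
  have hqH (h : H) (g : G) : q (h * g) = q g := by
    refine QuotientGroup.eq.mpr ?_
    simp [mul_inv_rev]
  have hψ (h : H) (g : G) : ψ (h * g) = e h * ψ g := by
    refine Eq.trans (congrArg e ?_) (map_mul e _ _)
    ext
    simp [hqH, mul_assoc]
  have hinj : Function.Injective fun g => (ψ g, q g) := by
    intro g g' hgg
    obtain ⟨h1, h2⟩ := Prod.ext_iff.mp hgg
    have h3 : g * (q g).out = g' * (q g').out := congrArg Subtype.val (e.injective h1)
    simp only at h2
    rw [h2] at h3
    exact mul_right_cancel h3
  have hdist (g b : G) : ∃ c : G ⧸ H,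
      (ψ g)⁻¹ * ψ (g * b) = (ψ c.out⁻¹)⁻¹ * ψ (c.out⁻¹ * b) := by
    refine ⟨q g, ?_⟩
    obtain ⟨h, hh⟩ : ∃ h : H, g = h * (q g).out⁻¹ := ⟨⟨_, hq g⟩, by simp⟩
    have h1 : ψ g = e h * ψ (q g).out⁻¹ := by rw [← hψ, ← hh]
    have h2 : ψ (g * b) = e h * ψ ((q g).out⁻¹ * b) := by rw [← hψ, ← mul_assoc, ← hh]
    rw [h1, h2]
    group
  refine ⟨_, inferInstance, ψ, fun k => ?_, fun b => ?_⟩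
  · have hfin' (c : G ⧸ H) : {b | ((ψ c.out⁻¹)⁻¹ * ψ (c.out⁻¹ * b)).norm ≤ k}.Finite := by
      have h1 : {x | ((ψ c.out⁻¹)⁻¹ * x).norm ≤ k}.Finite :=
        (finite_norm_le k).preimage (mul_right_injective _).injOn
      exact (h1.prod Set.finite_univ).preimage
        (f := fun b => (ψ (c.out⁻¹ * b), q (c.out⁻¹ * b)))
        (hinj.comp (mul_right_injective _)).injOn |>.subset fun b hb => ⟨hb, trivial⟩
    refine (Set.finite_iUnion hfin').subset ?_
    rintro b ⟨g, hg⟩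
    obtain ⟨c, hc⟩ := hdist g b
    exact Set.mem_iUnion.mpr ⟨c, by simpa only [Set.mem_ofPred_eq, ← hc] using hg⟩
  · obtain ⟨k, hk⟩ := (Set.finite_range
      fun c : G ⧸ H => ((ψ c.out⁻¹)⁻¹ * ψ (c.out⁻¹ * b)).norm).bddAbove
    refine ⟨k, fun g => ?_⟩
    obtain ⟨c, hc⟩ := hdist g b
    rw [hc]
    exact hk ⟨c, rfl⟩

variable {X : Type} (f : X → G)

/-- The value in the group of a sentential form whose nonterminals are group elements. -/
def formVal (s : List (Symbol (X ⊕ X) G)) : G :=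
  (s.map fun
    | .terminal a => val f [a]
    | .nonterminal b => b).prod

variable [Finite X]

lemma finite_contextFreeRules {B : Set G} (hB : B.Finite) :
    ({⟨1, []⟩} ∪ Set.range (fun a : X ⊕ X => ContextFreeRule.mk (val f [a]) [Symbol.terminal a]) ∪
      Set.image2 (fun b c => ContextFreeRule.mk (b * c) [Symbol.nonterminal b, Symbol.nonterminal c])
        B B).Finite :=
  ((Set.finite_singleton _).union (Set.finite_range _)).union (hB.image2 _ hB)

/-- The grammar with the multiplication rules `b * c → b c` for `b` and `c` in a finite set. -/
noncomputable abbrev mulGrammar {B : Set G} (hB : B.Finite) : ContextFreeGrammar (X ⊕ X) where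
  NT := G
  initial := 1
  rules := (finite_contextFreeRules f hB).toFinset

variable {f} {B : Set G} {hB : B.Finite}

lemma val_eq_formVal {s : List (Symbol (X ⊕ X) (mulGrammar f hB).NT)} {w : List (X ⊕ X)}
    (h : Gen (mulGrammar f hB) s w) : val f w = formVal f s := by
  induction h with
  | nil => simp [formVal]
  | terminal t _ ih =>
    rw [val_cons, ih]
    simp [formVal]
  | @nonterminal r s u v hr _ _ ih1 ih2 =>
    have hr' : formVal f r.output = r.input := by
      rcases (Set.Finite.mem_toFinset _).mp hr with (rfl | ⟨a, rfl⟩) | ⟨b, _, c, _, rfl⟩ <;>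
        simp [formVal]
    rw [val_append, ih1, ih2, hr']
    simp [formVal]

variable {Y : Type} [DecidableEq Y] {ψ : G → FreeGroup Y} {D : ℕ}

lemma gen_mulGrammar (hD : ∀ a g, ((ψ g)⁻¹ * ψ (g * val f [a])).norm ≤ D)
    (hBψ : ∀ b g, ((ψ g)⁻¹ * ψ (g * b)).norm ≤ 3 * D + 1 → b ∈ B) (w : List (X ⊕ X)) (g : G)
    (hw : ((ψ g)⁻¹ * ψ (g * val f w)).norm ≤ 3 * D + 1) :
    Gen (mulGrammar f hB) [Symbol.nonterminal (val f w)] w := by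
  have hrule (r) (hr : r ∈ (mulGrammar f hB).rules) (u) (h : Gen (mulGrammar f hB) r.output u) :
      Gen (mulGrammar f hB) [Symbol.nonterminal r.input] u := by
    simpa using Gen.nonterminal hr h Gen.nil
  induction hn : w.length using Nat.strong_induction_on generalizing w g with
  | _ n ih =>
  subst hn
  match w with
  | [] =>
    exact hrule ⟨1, []⟩ ((Set.Finite.mem_toFinset _).mpr (.inl (.inl rfl))) [] Gen.nil
  | [a] =>
    exact hrule ⟨val f [a], [Symbol.terminal a]⟩
      ((Set.Finite.mem_toFinset _).mpr (.inl (.inr ⟨a, rfl⟩))) [a] (Gen.nil.terminal a)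
  | a :: b :: w =>
    obtain ⟨v, hv⟩ : ∃ v, v = a :: b :: w := ⟨_, rfl⟩
    have hlen : 2 ≤ v.length := by simp [hv]
    rw [← hv] at hw ih ⊢
    obtain ⟨i, hi0, hin, h1, h2⟩ := exists_intermediate (D := D) hlen
      (fun i => (ψ g)⁻¹ * ψ (g * val f (v.take i))) (by simp)
      (fun i hi => by
        have h := hD v[i] (g * val f (v.take i))
        rw [mul_assoc, ← val_append, List.take_concat_get' v i hi] at h
        simpa [mul_assoc] using h)
      (by simpa using hw)
    rw [List.take_length] at h2
    have hval : val f (v.take i) * val f (v.drop i) = val f v := by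
      rw [← val_append, List.take_append_drop]
    have h3 : ((ψ (g * val f (v.take i)))⁻¹ *
        ψ (g * val f (v.take i) * val f (v.drop i))).norm ≤ 3 * D + 1 := by
      rw [mul_assoc, hval]
      simpa [mul_assoc] using h2
    have g1 := ih _ (by rw [List.length_take]; lia) (v.take i) g h1 rfl
    have g2 := ih _ (by rw [List.length_drop]; lia) (v.drop i) _ h3 rfl
    have := hrule ⟨_, [Symbol.nonterminal (val f (v.take i)),
        Symbol.nonterminal (val f (v.drop i))]⟩ ((Set.Finite.mem_toFinset _).mpr
        (.inr ⟨_, hBψ _ _ h1, _, hBψ _ _ h3, rfl⟩)) _ (g1.append g2)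
    simpa only [hval, List.take_append_drop] using this

lemma isContextFree_wordProblem (hgen : Subgroup.closure (Set.range f) = ⊤)
    (h : VirtuallyFree G) : (wordProblem f).IsContextFree := by
  have hfg : Group.FG G :=
    Group.fg_iff.mpr ⟨Set.range f, hgen, Set.finite_range f⟩
  obtain ⟨Y, _, ψ, hfin, hbdd⟩ := exists_map_freeGroup h
  choose k hk using hbdd
  obtain ⟨D, hD⟩ := (Set.finite_range fun a => k (val f [a])).bddAbove
  have hD' (a : X ⊕ X) (g : G) : ((ψ g)⁻¹ * ψ (g * val f [a])).norm ≤ D :=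
    (hk _ g).trans (hD ⟨a, rfl⟩)
  refine ⟨mulGrammar f (hfin (3 * D + 1)), ?_⟩
  ext w
  rw [mem_wordProblem, ContextFreeGrammar.mem_language_iff, ← gen_iff_derives]
  constructor
  · intro hw
    rw [val_eq_formVal hw]
    simp [formVal, mulGrammar]
  · intro hw
    have := gen_mulGrammar (hB := hfin (3 * D + 1)) hD' (fun b g h => ⟨g, h⟩) w 1 (by simp [hw])
    rwa [hw] at this

end Grammar

end MullerSchupp

theorem stmt_2 {X G : Type} [Group G] [Finite X] (f : X → G)
    (hgen : Subgroup.closure (Set.range f) = ⊤) :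
    (wordProblem f).IsContextFree ↔ VirtuallyFree G := by
  refine ⟨fun h => ?_, MullerSchupp.isContextFree_wordProblem hgen⟩
  obtain ⟨V, _, t, N, hN, hcard⟩ := MullerSchupp.exists_tree hgen h
  exact t.virtuallyFree hN hcard
end

section
/- The modular group PSL(2, ℤ), i.e. the quotient of the special linear group SL(2, ℤ) of 2×2 integer matrices of determinant 1 by its center, is isomorphic as a group to the free product (ℤ/2ℤ) ∗ (ℤ/3ℤ) of cyclic groups of orders 2 and 3. -/
open Matrix in
theorem Matrix.SpecialLinearGroup.mem_center_fin_two_int_iff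
    {A : SpecialLinearGroup (Fin 2) ℤ} :
    A ∈ Subgroup.center (SpecialLinearGroup (Fin 2) ℤ) ↔ A = 1 ∨ A = -1 := by
  constructor
  · intro hA
    obtain ⟨r, hr, hrA⟩ := mem_center_iff.mp hA
    rw [Fintype.card_fin, sq_eq_one_iff] at hr
    rcases hr with rfl | rfl
    · exact .inl (Subtype.ext (by simp [← hrA]))
    · exact .inr (Subtype.ext (by simp [← hrA]))
  · rintro (rfl | rfl)
    · exact one_mem _
    · exact Subgroup.mem_center_iff.mpr fun B => by simp

/-- The homomorphism from the cyclic group of order `n` sending the generator to an element whose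
`n`-th power is trivial. -/
def zmodPowHom {G : Type*} [Group G] (n : ℕ) (g : G) (hg : g ^ n = 1) :
    Multiplicative (ZMod n) →* G :=
  AddMonoidHom.toMultiplicativeLeft
    (ZMod.lift n ⟨zmultiplesHom (Additive G) (Additive.ofMul g), by
      simpa using congrArg Additive.ofMul hg⟩)

theorem zmodPowHom_ofAdd_natCast {G : Type*} [Group G] (n : ℕ) (g : G) (hg : g ^ n = 1) (k : ℕ) :
    zmodPowHom n g hg (Multiplicative.ofAdd (k : ZMod n)) = g ^ k := by
  have h := ZMod.lift_coe n ⟨zmultiplesHom (Additive G) (Additive.ofMul g), by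
    simpa using congrArg Additive.ofMul hg⟩ (k : ℤ)
  rw [Int.cast_natCast] at h
  change Additive.toMul (ZMod.lift n _ (k : ZMod n)) = _
  rw [h]
  simp

namespace Monoid.Coprod

/-- The comparison map from a binary free product to the free product indexed by `Bool`. -/
def toCoprodI (H : Bool → Type*) [∀ b, Group (H b)] :
    Monoid.Coprod (H false) (H true) →* Monoid.CoprodI H :=
  lift CoprodI.of CoprodI.of

theorem toCoprodI_injective (H : Bool → Type*) [∀ b, Group (H b)] :
    Function.Injective (toCoprodI H) := by
  let ψ : Monoid.CoprodI H →* Monoid.Coprod (H false) (H true) :=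
    CoprodI.lift fun b => match b with
      | false => inl
      | true => inr
  have h : ψ.comp (toCoprodI H) = MonoidHom.id _ := by
    ext x <;> simp [ψ, toCoprodI]
  exact Function.LeftInverse.injective (g := ψ) (DFunLike.congr_fun h)

/-- The ping-pong lemma for the free product of two groups. -/
theorem lift_injective_of_ping_pong {H : Bool → Type} [∀ b, Group (H b)] {G α : Type*} [Group G]
    [MulAction G α] (f : ∀ b, H b →* G) (hcard : 3 ≤ Cardinal.mk (H true)) (X : Bool → Set α)
    (hne : ∀ b, (X b).Nonempty) (hdisj : Disjoint (X false) (X true))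
    (hfalse : ∀ h : H false, h ≠ 1 → ∀ x ∈ X true, f false h • x ∈ X false)
    (htrue : ∀ h : H true, h ≠ 1 → ∀ x ∈ X false, f true h • x ∈ X true) :
    Function.Injective (lift (f false) (f true)) := by
  have hf : lift (f false) (f true) = (CoprodI.lift f).comp (toCoprodI H) := by
    ext x <;> simp [toCoprodI]
  rw [hf, MonoidHom.coe_comp]
  refine Function.Injective.comp ?_ (toCoprodI_injective H)
  refine CoprodI.lift_injective_of_ping_pong f (.inr ⟨true, hcard⟩) X hne ?_ ?_
  · rintro (_ | _) (_ | _) h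
    exacts [(h rfl).elim, hdisj, hdisj.symm, (h rfl).elim]
  · rintro (_ | _) (_ | _) h k hk
    · exact (h rfl).elim
    · exact Set.smul_set_subset_iff.mpr (hfalse k hk)
    · exact Set.smul_set_subset_iff.mpr (htrue k hk)
    · exact (h rfl).elim

end Monoid.Coprod

namespace ModularGroup

open Matrix Matrix.SpecialLinearGroup MatrixGroups

theorem coe_S_mul_T : ((S * T : SL(2, ℤ)) : Matrix (Fin 2) (Fin 2) ℤ) = !![0, -1; 1, 1] := by
  rw [coe_mul, coe_S, coe_T]
  simp

theorem mk_S_sq : (QuotientGroup.mk S : PSL(2, ℤ)) ^ 2 = 1 := by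
  rw [← QuotientGroup.mk_pow, QuotientGroup.eq_one_iff, mem_center_fin_two_int_iff]
  right
  ext i j
  fin_cases i <;> fin_cases j <;> simp [sq, coe_S]

theorem mk_S_mul_T_cube : (QuotientGroup.mk (S * T) : PSL(2, ℤ)) ^ 3 = 1 := by
  rw [← QuotientGroup.mk_pow, QuotientGroup.eq_one_iff, mem_center_fin_two_int_iff]
  right
  apply Subtype.ext
  rw [coe_pow, coe_S_mul_T]
  decide

/-- The product of the entries of the first column, as a function on `PSL(2, ℤ)`. -/
def firstColProd : PSL(2, ℤ) → ℤ :=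
  Quotient.lift (fun g : SL(2, ℤ) => g 0 0 * g 1 0) fun a b h => by
    have h' : a⁻¹ * b ∈ Subgroup.center SL(2, ℤ) := QuotientGroup.leftRel_apply.mp h
    rw [mem_center_fin_two_int_iff, inv_mul_eq_iff_eq_mul, inv_mul_eq_iff_eq_mul] at h'
    rcases h' with rfl | rfl <;> simp

theorem firstColProd_mk (g : SL(2, ℤ)) :
    firstColProd (QuotientGroup.mk g) = g 0 0 * g 1 0 := rfl

theorem firstColProd_S_mul (x : PSL(2, ℤ)) :
    firstColProd (QuotientGroup.mk S * x) = -firstColProd x := by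
  induction x using QuotientGroup.induction_on with | _ g
  rw [← QuotientGroup.mk_mul, firstColProd_mk, firstColProd_mk, coe_mul, coe_S]
  simp [Matrix.mul_apply]
  ring

theorem firstColProd_S_mul_T_mul_neg {x : PSL(2, ℤ)} (hx : 0 < firstColProd x) :
    firstColProd (QuotientGroup.mk (S * T) * x) < 0 := by
  induction x using QuotientGroup.induction_on with | _ g
  rw [firstColProd_mk] at hx
  rw [← QuotientGroup.mk_mul, firstColProd_mk, coe_mul, coe_S_mul_T]
  simp [Matrix.mul_apply]
  nlinarith [sq_nonneg (g 1 0)]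

theorem firstColProd_S_mul_T_sq_mul_neg {x : PSL(2, ℤ)} (hx : 0 < firstColProd x) :
    firstColProd (QuotientGroup.mk (S * T) ^ 2 * x) < 0 := by
  induction x using QuotientGroup.induction_on with | _ g
  rw [firstColProd_mk] at hx
  rw [← QuotientGroup.mk_pow, ← QuotientGroup.mk_mul, firstColProd_mk, coe_mul, coe_pow,
    coe_S_mul_T]
  simp [Matrix.mul_apply, sq]
  nlinarith [sq_nonneg (g 0 0)]

/-- The homomorphisms from the cyclic groups of orders `2` and `3` to `PSL(2, ℤ)` given by the
classes of `S` and `S * T`. -/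
def cyclicHom : ∀ b : Bool, Multiplicative (ZMod (cond b 3 2)) →* PSL(2, ℤ)
  | false => zmodPowHom 2 (QuotientGroup.mk S) mk_S_sq
  | true => zmodPowHom 3 (QuotientGroup.mk (S * T)) mk_S_mul_T_cube

theorem lift_cyclicHom_injective :
    Function.Injective (Monoid.Coprod.lift (cyclicHom false) (cyclicHom true)) := by
  refine Monoid.Coprod.lift_injective_of_ping_pong (α := PSL(2, ℤ)) cyclicHom ?_
    (fun b => cond b {x | firstColProd x < 0} {x | 0 < firstColProd x}) ?_ ?_ ?_ ?_
  · change 3 ≤ Cardinal.mk (ZMod 3)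
    simp
  · have h : 0 < firstColProd (QuotientGroup.mk T.transpose) := by
      simp [firstColProd_mk, coe_T]
    rintro (_ | _)
    · exact ⟨_, h⟩
    · exact ⟨_, firstColProd_S_mul_T_mul_neg h⟩
  · exact Set.disjoint_left.mpr fun x hx hx' => lt_asymm (Set.mem_ofPred.mp hx) hx'
  · intro h hh x hx
    change firstColProd x < 0 at hx
    change 0 < firstColProd (zmodPowHom 2 (QuotientGroup.mk S) mk_S_sq h * x)
    obtain rfl : h = Multiplicative.ofAdd ((1 : ℕ) : ZMod 2) := by
      revert h
      change ∀ h : Multiplicative (ZMod 2), _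
      decide
    rw [zmodPowHom_ofAdd_natCast, pow_one, firstColProd_S_mul]
    exact neg_pos.mpr hx
  · intro h hh x hx
    change 0 < firstColProd x at hx
    change firstColProd (zmodPowHom 3 (QuotientGroup.mk (S * T)) mk_S_mul_T_cube h * x) < 0
    obtain rfl | rfl : h = Multiplicative.ofAdd ((1 : ℕ) : ZMod 3) ∨
        h = Multiplicative.ofAdd ((2 : ℕ) : ZMod 3) := by
      revert h
      change ∀ h : Multiplicative (ZMod 3), _
      decide
    · rw [zmodPowHom_ofAdd_natCast, pow_one]
      exact firstColProd_S_mul_T_mul_neg hx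
    · rw [zmodPowHom_ofAdd_natCast]
      exact firstColProd_S_mul_T_sq_mul_neg hx

theorem lift_cyclicHom_surjective :
    Function.Surjective (Monoid.Coprod.lift (cyclicHom false) (cyclicHom true)) := by
  set φ := Monoid.Coprod.lift (cyclicHom false) (cyclicHom true) with hφ
  have hS : (QuotientGroup.mk S : PSL(2, ℤ)) ∈ φ.range :=
    ⟨Monoid.Coprod.inl (Multiplicative.ofAdd ((1 : ℕ) : ZMod 2)),
      (zmodPowHom_ofAdd_natCast 2 _ mk_S_sq 1).trans (pow_one _)⟩
  have hST : (QuotientGroup.mk (S * T) : PSL(2, ℤ)) ∈ φ.range :=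
    ⟨Monoid.Coprod.inr (Multiplicative.ofAdd ((1 : ℕ) : ZMod 3)),
      (zmodPowHom_ofAdd_natCast 3 _ mk_S_mul_T_cube 1).trans (pow_one _)⟩
  have hT : (QuotientGroup.mk T : PSL(2, ℤ)) ∈ φ.range := by
    rw [QuotientGroup.mk_mul] at hST
    exact (Subgroup.mul_mem_cancel_left _ hS).mp hST
  have hle : Subgroup.closure {S, T} ≤
      φ.range.comap (QuotientGroup.mk' (Subgroup.center SL(2, ℤ))) := by
    rw [Subgroup.closure_le]
    rintro _ (rfl | rfl)
    exacts [hS, hT]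
  rw [SpecialLinearGroup.SL2Z_generators] at hle
  intro x
  induction x using QuotientGroup.induction_on with | _ g
  exact hle (Subgroup.mem_top g)

end ModularGroup

theorem stmt_6 :
    Nonempty (Matrix.ProjectiveSpecialLinearGroup (Fin 2) ℤ ≃*
      Monoid.Coprod (Multiplicative (ZMod 2)) (Multiplicative (ZMod 3))) :=
  ⟨(MulEquiv.ofBijective (Monoid.Coprod.lift (ModularGroup.cyclicHom false)
      (ModularGroup.cyclicHom true))
    ⟨ModularGroup.lift_cyclicHom_injective, ModularGroup.lift_cyclicHom_surjective⟩).symm⟩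
end
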